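/- Let n ≥ 1 and let f be a slice regular self-map of 𝔹 which is not a regular Blaschke product of degree ≤ n. Then for all p₁, …, pₙ ∈ 𝔹 the iterated hyperbolic difference quotients f^{⟨κ⟩}_{p₁,…,p_κ}, κ = 1, …, n, are all well-defined slice regular self-maps of 𝔹, and |f^{⟨n⟩}_{p₁,…,pₙ}(q)| < 1 for every q ∈ 𝔹. -/

import Mathlib

noncomputable section

abbrev H : Type := Quaternion ℝ

namespace QPaper

/-- The complex slice determined by `I`: the real span of `1` and `I`. -/
def sliceSet (I : H) : Set H := {q | ∃ x y : ℝ, q = (x : H) + y • I}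

/-- Evaluation of the power series `q ↦ ∑ qᵐ aₘ` with right coefficients. -/
def evalC (a : ℕ → H) (q : H) : H := ∑' m, q ^ m * a m

/-- The series with coefficients `a` converges at every point of the unit ball. -/
def SummableOn (a : ℕ → H) : Prop := ∀ q : H, ‖q‖ < 1 → Summable fun m => q ^ m * a m

/-- `a` are the coefficients of a slice regular self-map of the unit ball. -/
def SelfMap (a : ℕ → H) : Prop :=
  SummableOn a ∧ ∀ q : H, ‖q‖ < 1 → ‖evalC a q‖ < 1

/-- Coefficients of the ∗-product. -/
def starMulC (a b : ℕ → H) : ℕ → H := fun m => ∑ ℓ ∈ Finset.range (m + 1), a (m - ℓ) * b ℓ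

/-- Coefficients of the ∗-inverse (of a series with invertible constant term). -/
def starInvC (a : ℕ → H) : ℕ → H
  | 0 => (a 0)⁻¹
  | m + 1 => -(a 0)⁻¹ * ∑ ℓ : Fin (m + 1), a (m + 1 - ℓ.val) * starInvC a ℓ.val
  decreasing_by exact ℓ.isLt

/-- Coefficients of `1 - q p̄`. -/
def oneMinusQPbarC (p : H) : ℕ → H := fun m => if m = 0 then 1 else if m = 1 then -(star p) else 0

/-- Coefficients of `q - p`. -/
def qMinusPC (p : H) : ℕ → H := fun m => if m = 0 then -p else if m = 1 then 1 else 0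

/-- Coefficients of the regular Möbius transformation `ℳ_p = (1 - q p̄)^{-∗} ∗ (q - p)`. -/
def mobiusC (p : H) : ℕ → H := starMulC (starInvC (oneMinusQPbarC p)) (qMinusPC p)

/-- Coefficients of `ℳ_{t₁} ∗ ⋯ ∗ ℳ_{t_κ}`. -/
def blaschkeListC : List H → (ℕ → H)
  | [] => fun m => if m = 0 then 1 else 0
  | t :: ts => starMulC (mobiusC t) (blaschkeListC ts)

/-- `a` are the coefficients of a regular Blaschke product of degree `κ`,
i.e. of `ℳ_{t₁} ∗ ⋯ ∗ ℳ_{t_κ} u` with the `tᵢ` in `𝔹` and `u` unimodular. -/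
def IsBlaschke (a : ℕ → H) (κ : ℕ) : Prop :=
  ∃ (ts : List H) (u : H), ts.length = κ ∧ (∀ t ∈ ts, ‖t‖ < 1) ∧ ‖u‖ = 1 ∧
    a = fun m => blaschkeListC ts m * u

/-- Coefficients of `ℳ_w ∙ f = (1 - f w̄)^{-∗} ∗ (f - w)`. -/
def bulletC (w : H) (a : ℕ → H) : ℕ → H :=
  starMulC (starInvC (fun m => (if m = 0 then (1 : H) else 0) - a m * star w))
    (fun m => a m - if m = 0 then w else 0)

/-- Coefficients of the regular difference quotient `ℛ_{f,p}`,
the unique slice regular function with `f(q) = f(p) + (q - p) ∗ ℛ_{f,p}(q)`. -/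
def diffQuotC (a : ℕ → H) (p : H) : ℕ → H := fun m => ∑' k, p ^ k * a (k + m + 1)

/-- Coefficients of the hyperbolic difference quotient
`f⋆_p = (1 - q p̄) ∗ ℛ_{f,p} ∗ (1 - \overline{f(p)} f)^{-∗} = ℳ_p^{-∗} ∗ (ℳ_{f(p)} ∙ f)`. -/
def hdqC (a : ℕ → H) (p : H) : ℕ → H :=
  starMulC (starMulC (oneMinusQPbarC p) (diffQuotC a p))
    (starInvC (fun m => (if m = 0 then (1 : H) else 0) - star (evalC a p) * a m))

/-- Iterated hyperbolic difference quotients: `ihdqC a [p₁, …, pₙ] = ((f⋆_{p₁})⋆_{p₂} ⋯)⋆_{pₙ}`. -/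
def ihdqC (a : ℕ → H) : List H → (ℕ → H)
  | [] => a
  | p :: ps => ihdqC (hdqC a p) ps

/-- `𝒯_p(q) = (1 - q p)⁻¹ q (1 - q p)`. -/
def mobiusT (p q : H) : H := (1 - q * p)⁻¹ * q * (1 - q * p)

/-- `M_p(q) = (1 - q p̄)⁻¹ (q - p)`. -/
def mobiusM (p q : H) : H := (1 - q * star p)⁻¹ * (q - p)

/-- Pointwise evaluation of the regular Möbius transformation: `ℳ_p(q) = M_p(𝒯_p(q))`. -/
def mobiusEval (p q : H) : H := mobiusM p (mobiusT p q)

/-- The pseudo-hyperbolic distance `ρ(p,q) = |M_p(q)|`. -/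
def rho (p q : H) : ℝ := ‖mobiusM p q‖

/-- The Poincaré distance `δ(p,q) = tanh⁻¹ ρ(p,q) = ½ log((1+ρ)/(1−ρ))`. -/
def pdist (p q : H) : ℝ := (1/2 : ℝ) * Real.log ((1 + rho p q) / (1 - rho p q))


section Helpers
open PowerSeries
lemma diffOn_tsum (α : ℕ → ℂ) (hs : ∀ r : ℝ, 0 ≤ r → r < 1 → Summable fun m => r ^ m * ‖α m‖) :
    DifferentiableOn ℂ (fun z => ∑' m, z ^ m * α m) (Metric.ball 0 1) := by
  intro z hz
  rw [mem_ball_zero_iff] at hz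
  obtain ⟨r, h1, h2⟩ := exists_between hz
  have h0 : 0 ≤ r := (norm_nonneg z).trans h1.le
  have := Complex.differentiableOn_tsum_of_summable_norm (F := fun m (z : ℂ) => z ^ m * α m) (U := Metric.ball 0 r)
    (hs r h0 h2) (fun i => by fun_prop) Metric.isOpen_ball (fun i w hw => by
      rw [mem_ball_zero_iff] at hw
      rw [norm_mul, norm_pow]; gcongr)
  exact (this.differentiableAt (Metric.isOpen_ball.mem_nhds (by simpa using h1))).differentiableWithinAt

lemma cauchy_coeff (α : ℕ → ℂ) (hs : ∀ r : ℝ, 0 ≤ r → r < 1 → Summable fun m => r ^ m * ‖α m‖)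
    (M : ℝ) (hM : ∀ z : ℂ, ‖z‖ < 1 → ‖∑' m, z ^ m * α m‖ ≤ M) (m : ℕ) : ‖α m‖ ≤ M := by
  set φ : ℂ → ℂ := fun z => ∑' m, z ^ m * α m with hφ
  have hd := diffOn_tsum α hs
  have key : ∀ r : ℝ, 0 < r → r < 1 → ‖α m‖ * r ^ m ≤ M := by
    intro r h0 h1
    have hp : HasFPowerSeriesOnBall φ (FormalMultilinearSeries.ofScalars ℂ α) 0 (ENNReal.ofReal r) := by
      refine ⟨?_, by simpa using h0, ?_⟩
      · apply FormalMultilinearSeries.le_radius_of_summable_norm (r := r.toNNReal)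
        simp only [FormalMultilinearSeries.ofScalars_norm, Real.coe_toNNReal r h0.le]
        simpa [mul_comm] using hs r h0.le h1
      · intro y hy
        have hy' : ‖y‖ < r := by
          simpa [Metric.mem_eball, edist_zero_right, ← ofReal_norm, ENNReal.ofReal_lt_ofReal_iff h0] using hy
        have : Summable fun m => y ^ m * α m := by
          apply Summable.of_norm
          simpa using hs ‖y‖ (norm_nonneg y) (hy'.trans h1)
        simp only [FormalMultilinearSeries.ofScalars_apply_eq, zero_add, smul_eq_mul]
        have h5 : HasSum (fun m => y ^ m * α m) (φ y) := this.hasSum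
        simpa only [mul_comm] using h5
    have h2 := hp.factorial_smul 1 m
    rw [← iteratedDeriv_eq_iteratedFDeriv] at h2
    simp only [FormalMultilinearSeries.ofScalars_apply_eq, one_pow, smul_eq_mul, mul_one] at h2
    have h3 := Complex.norm_iteratedDeriv_le_of_forall_mem_sphere_norm_le (c := 0) (R := r) (C := M) (f := φ) m h0
      ((hd.mono (by
        intro x hx; simp at hx ⊢; linarith : Metric.closedBall (0:ℂ) r ⊆ _)).diffContOnCl_ball subset_rfl) (by
        intro z hz; apply hM; simp at hz; linarith)
    rw [← h2] at h3
    simp only [nsmul_eq_mul, norm_mul, Complex.norm_natCast] at h3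
    have hf : (0:ℝ) < m.factorial := by exact_mod_cast m.factorial_pos
    rw [mul_div_assoc] at h3
    have h4 := le_of_mul_le_mul_left h3 hf
    rwa [le_div_iff₀ (by positivity)] at h4
  have ht : Filter.Tendsto (fun r : ℝ => ‖α m‖ * r ^ m) (nhdsWithin 1 (Set.Iio 1)) (nhds (‖α m‖ * 1 ^ m)) := by
    apply Filter.Tendsto.mono_left _ nhdsWithin_le_nhds
    exact Continuous.tendsto (by fun_prop) 1
  rw [one_pow, mul_one] at ht
  refine le_of_tendsto ht ?_
  filter_upwards [Ioo_mem_nhdsLT (show (0:ℝ) < 1 by norm_num)] with r hr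
  exact key r hr.1 hr.2

/-! ### power series -/

abbrev PS := PowerSeries H

noncomputable def ev (f : PS) (q : H) : H := evalC (fun m => coeff m f) q
def Conv (f : PS) : Prop := SummableOn (fun m => coeff m f)
def Schur (f : PS) : Prop := Conv f ∧ ∀ q : H, ‖q‖ < 1 → ‖ev f q‖ ≤ 1

lemma conv_iff (f : PS) : Conv f ↔ ∀ r : ℝ, 0 ≤ r → r < 1 → Summable fun m => r ^ m * ‖coeff m f‖ := by
  constructor
  · intro h r h0 h1
    have := summable_norm_iff.2 (h (r : H) (by simpa [abs_of_nonneg h0] using h1))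
    simpa [norm_mul, norm_pow, abs_of_nonneg h0] using this
  · intro h q hq
    rw [← summable_norm_iff]
    simpa [norm_mul, norm_pow] using h ‖q‖ (norm_nonneg q) hq

lemma Conv.norm {f : PS} (h : Conv f) {q : H} (hq : ‖q‖ < 1) : Summable fun m => ‖q ^ m * coeff m f‖ :=
  summable_norm_iff.2 (h q hq)

lemma Conv.add {f g : PS} (hf : Conv f) (hg : Conv g) : Conv (f + g) := by
  intro q hq; simpa [mul_add] using (hf q hq).add (hg q hq)
lemma Conv.sub {f g : PS} (hf : Conv f) (hg : Conv g) : Conv (f - g) := by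
  intro q hq; simpa [mul_sub] using (hf q hq).sub (hg q hq)
lemma ev_add {f g : PS} (hf : Conv f) (hg : Conv g) {q : H} (hq : ‖q‖ < 1) : ev (f + g) q = ev f q + ev g q := by
  simpa [ev, evalC, mul_add] using (hf q hq).tsum_add (hg q hq)
lemma ev_sub {f g : PS} (hf : Conv f) (hg : Conv g) {q : H} (hq : ‖q‖ < 1) : ev (f - g) q = ev f q - ev g q := by
  simpa [ev, evalC, mul_sub] using (hf q hq).tsum_sub (hg q hq)

def IsPoly (k : ℕ) (f : PS) : Prop := ∀ m, k < m → coeff m f = 0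

lemma IsPoly.conv {k : ℕ} {f : PS} (h : IsPoly k f) : Conv f := by
  intro q hq
  apply summable_of_ne_finset_zero (s := Finset.range (k+1))
  intro m hm
  simp only [Finset.mem_range, not_lt] at hm
  simp [h m (by omega)]

lemma IsPoly.ev {k : ℕ} {f : PS} (h : IsPoly k f) (q : H) : ev f q = ∑ m ∈ Finset.range (k+1), q ^ m * coeff m f := by
  apply tsum_eq_sum
  intro m hm
  simp only [Finset.mem_range, not_lt] at hm
  simp [h m (by omega)]

lemma isPoly_C (c : H) : IsPoly 0 (C c : PS) := by
  intro m hm; rw [coeff_C, if_neg (by omega)]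
lemma isPoly_one : IsPoly 0 (1 : PS) := by
  have := isPoly_C 1; simpa using this
lemma isPoly_X : IsPoly 1 (X : PS) := by
  intro m hm; rw [coeff_X, if_neg (by omega)]
lemma IsPoly.mono {k l : ℕ} {f : PS} (h : IsPoly k f) (hl : k ≤ l) : IsPoly l f := fun m hm => h m (by omega)
lemma IsPoly.add {k : ℕ} {f g : PS} (h : IsPoly k f) (h' : IsPoly k g) : IsPoly k (f + g) := fun m hm => by
  simp [h m hm, h' m hm]
lemma IsPoly.sub {k : ℕ} {f g : PS} (h : IsPoly k f) (h' : IsPoly k g) : IsPoly k (f - g) := fun m hm => by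
  simp [h m hm, h' m hm]
lemma IsPoly.mul {k l : ℕ} {f g : PS} (h : IsPoly k f) (h' : IsPoly l g) : IsPoly (k + l) (f * g) := fun m hm => by
  rw [coeff_mul]
  apply Finset.sum_eq_zero
  intro x hx
  rw [Finset.HasAntidiagonal.mem_antidiagonal] at hx
  by_cases h1 : k < x.1
  · simp [h _ h1]
  · simp [h' x.2 (by omega)]

lemma conv_C (c : H) : Conv (C c : PS) := (isPoly_C c).conv
lemma conv_one : Conv (1 : PS) := isPoly_one.conv
lemma conv_X : Conv (X : PS) := isPoly_X.conv
lemma ev_C (c q : H) : ev (C c) q = c := by simp [(isPoly_C c).ev]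
lemma ev_one (q : H) : ev 1 q = 1 := by simp [isPoly_one.ev]
lemma ev_X (q : H) : ev X q = q := by simp [isPoly_X.ev, Finset.sum_range_succ, coeff_X]

lemma conv_of_bdd {f : PS} {K : ℝ} (h : ∀ m, ‖coeff m f‖ ≤ K) : Conv f := by
  rw [conv_iff]
  intro r h0 h1
  refine Summable.of_nonneg_of_le (fun m => by positivity) (fun m => ?_) ((summable_geometric_of_lt_one h0 h1).mul_right K)
  gcongr; exact h m

lemma Conv.mul {f g : PS} (hf : Conv f) (hg : Conv g) : Conv (f * g) := by
  rw [conv_iff] at *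
  intro r h0 h1
  have h := summable_norm_sum_mul_antidiagonal_of_summable_norm (f := fun m => r ^ m * ‖coeff m f‖) (g := fun m => r ^ m * ‖coeff m g‖)
    (by simpa [abs_of_nonneg h0] using hf r h0 h1) (by simpa [abs_of_nonneg h0] using hg r h0 h1)
  refine Summable.of_nonneg_of_le (fun m => by positivity) (fun m => ?_) h
  rw [coeff_mul, Real.norm_of_nonneg (by positivity)]
  calc _ ≤ r ^ m * ∑ x ∈ Finset.HasAntidiagonal.antidiagonal m, ‖coeff x.1 f‖ * ‖coeff x.2 g‖ := by
        gcongr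
        refine (norm_sum_le _ _).trans (le_of_eq ?_)
        simp [norm_mul]
    _ = _ := by
        rw [Finset.mul_sum]
        apply Finset.sum_congr rfl
        intro x hx
        rw [Finset.HasAntidiagonal.mem_antidiagonal] at hx
        rw [← hx, pow_add]; ring

lemma ev_mul_aux {f g : PS} (hf : Conv f) (hg : Conv g) {q : H} (hq : ‖q‖ < 1) :
    ev (f * g) q = ∑' j, q ^ j * ev f q * coeff j g := by
  set T : ℕ × ℕ → H := fun x => q ^ x.2 * (q ^ x.1 * coeff x.1 f) * coeff x.2 g with hT
  have hs : Summable T := by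
    rw [← summable_norm_iff]
    have := (hf.norm hq).mul_of_nonneg (hg.norm hq) (fun _ => norm_nonneg _) (fun _ => norm_nonneg _)
    refine this.congr (fun x => ?_)
    simp only [hT, norm_mul]; ring
  have e1 : ev (f * g) q = ∑' x, T x := by
    rw [← Finset.HasAntidiagonal.sigmaAntidiagonalEquivProd.tsum_eq, Summable.tsum_sigma']
    · simp only [ev, evalC]
      congr 1; ext1 m
      rw [tsum_fintype, coeff_mul, Finset.mul_sum, ← Finset.sum_finset_coe]
      apply Finset.sum_congr rfl
      rintro ⟨x, hx⟩ -
      simp only [SetLike.mem_coe, Finset.HasAntidiagonal.mem_antidiagonal] at hx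
      simp only [hT, Finset.HasAntidiagonal.sigmaAntidiagonalEquivProd_apply]
      rw [← hx, add_comm, pow_add]; simp only [mul_assoc]
    · exact fun n => (hasSum_fintype _).summable
    · exact (Finset.HasAntidiagonal.sigmaAntidiagonalEquivProd).summable_iff.2 hs
  have hs' : Summable (T ∘ Prod.swap) := (Equiv.prodComm ℕ ℕ).summable_iff.2 hs
  rw [e1, ← (Equiv.prodComm ℕ ℕ).tsum_eq]
  refine (Summable.tsum_prod hs').trans ?_
  congr 1; ext1 j
  simp only [hT, Function.comp, Prod.swap]
  rw [tsum_mul_right, tsum_mul_left]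
  rfl

/-- conjugation -/
noncomputable def cj (c q : H) : H := c⁻¹ * q * c

lemma norm_cj {c : H} (hc : c ≠ 0) (q : H) : ‖cj c q‖ = ‖q‖ := by
  have : ‖c‖ ≠ 0 := by simpa using hc
  simp only [cj, norm_mul, norm_inv]; field_simp

lemma norm_cj_lt (c : H) {q : H} (hq : ‖q‖ < 1) : ‖cj c q‖ < 1 := by
  by_cases hc : c = 0
  · simp [cj, hc]
  · rwa [norm_cj hc]

lemma ev_mul {f g : PS} (hf : Conv f) (hg : Conv g) {q : H} (hq : ‖q‖ < 1) :
    ev (f * g) q = ev f q * ev g (cj (ev f q) q) := by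
  rw [ev_mul_aux hf hg hq]
  by_cases hc : ev f q = 0
  · simp [hc]
  · simp only [ev, evalC] at *
    rw [← tsum_mul_left]
    congr 1; ext1 j
    rw [cj, GroupWithZero.conj_pow₀ hc]
    rw [← mul_assoc, ← mul_assoc, ← mul_assoc, mul_inv_cancel₀ hc, one_mul]


@[simp] lemma one_re' : (1 : H).re = 1 := rfl
@[simp] lemma one_imI' : (1 : H).imI = 0 := rfl
@[simp] lemma one_imJ' : (1 : H).imJ = 0 := rfl
@[simp] lemma one_imK' : (1 : H).imK = 0 := rfl

noncomputable def iH : H := ⟨0, 1, 0, 0⟩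
lemma iH_sq : iH * iH = -1 := by
  ext <;> simp only [Quaternion.re_mul, Quaternion.imI_mul, Quaternion.imJ_mul, Quaternion.imK_mul] <;> simp [iH]

lemma exists_slice (x : H) : ∃ (I : H) (n : ℝ), I * I = -1 ∧ 0 ≤ n ∧ x = (x.re : H) + n • I := by
  by_cases h : x.im = 0
  · refine ⟨iH, 0, iH_sq, le_rfl, ?_⟩
    · conv_lhs => rw [← Quaternion.re_add_im x, h]
      simp
  · have hn : ‖x.im‖ ≠ 0 := by simpa using h
    refine ⟨‖x.im‖⁻¹ • x.im, ‖x.im‖, ?_, norm_nonneg _, ?_⟩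
    · rw [smul_mul_smul_comm, ← sq x.im, Quaternion.im_sq, Quaternion.normSq_eq_norm_mul_self]
      rw [smul_neg, Quaternion.smul_coe]
      congr 1
      rw [show ‖x.im‖⁻¹ * ‖x.im‖⁻¹ * (‖x.im‖ * ‖x.im‖) = 1 by field_simp]; simp
    · rw [smul_smul, mul_inv_cancel₀ hn, one_smul, Quaternion.re_add_im]

lemma unit_props {I : H} (hI : I * I = -1) : I.re = 0 ∧ ‖I‖ = 1 ∧ star I = -I := by
  have h1 : ‖I‖ = 1 := by
    have := congrArg norm hI
    rw [norm_mul, norm_neg, norm_one] at this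
    nlinarith [norm_nonneg I]
  have h0 : I.re = 0 := by
    rw [← Quaternion.sq_eq_neg_normSq, Quaternion.normSq_eq_norm_mul_self, h1, sq, hI]; simp
  refine ⟨h0, h1, ?_⟩
  exact Quaternion.star_eq_neg.2 h0

noncomputable def sl (I : H) (z : ℂ) : H := (z.re : H) + z.im • I

lemma sl_mul {I : H} (hI : I * I = -1) (z w : ℂ) : sl I (z * w) = sl I z * sl I w := by
  simp only [sl, add_mul, mul_add, smul_mul_smul_comm, hI, Complex.mul_re, Complex.mul_im]
  ext <;> simp <;> ring
lemma sl_one (I : H) : sl I 1 = 1 := by simp [sl]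
lemma sl_pow {I : H} (hI : I * I = -1) (z : ℂ) (m : ℕ) : sl I (z ^ m) = sl I z ^ m := by
  induction m with
  | zero => simp [sl_one]
  | succ m ih => rw [pow_succ, sl_mul hI, ih, pow_succ]

lemma norm_sl {I : H} (hI : I * I = -1) (z : ℂ) : ‖sl I z‖ = ‖z‖ := by
  obtain ⟨h0, h1, h2⟩ := unit_props hI
  have : ‖sl I z‖ * ‖sl I z‖ = ‖z‖ * ‖z‖ := by
    rw [← Quaternion.normSq_eq_norm_mul_self, sl, Quaternion.normSq_add, Quaternion.normSq_coe,
      Quaternion.normSq_smul, Quaternion.normSq_eq_norm_mul_self, h1, Complex.norm_mul_self_eq_normSq, Complex.normSq_apply]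
    simp [h0]; ring
  nlinarith [norm_nonneg (sl I z), norm_nonneg z]

lemma exists_sl (q : H) : ∃ (I : H) (z : ℂ), I * I = -1 ∧ q = sl I z := by
  obtain ⟨I, n, h, -, h2⟩ := exists_slice q
  exact ⟨I, ⟨q.re, n⟩, h, h2⟩

noncomputable def LL (I c : H) : H →L[ℝ] ℂ :=
  LinearMap.toContinuousLinearMap
    { toFun := fun x => ⟨(x * star c).re, -(I * x * star c).re⟩
      map_add' := fun x y => by apply Complex.ext <;> simp [add_mul, mul_add] <;> ring
      map_smul' := fun r x => by apply Complex.ext <;> simp <;> ring }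

lemma LL_apply (I c x : H) : LL I c x = ⟨(x * star c).re, -(I * x * star c).re⟩ := rfl

lemma LL_sl {I : H} (hI : I * I = -1) (c x : H) (z : ℂ) : LL I c (sl I z * x) = z * LL I c x := by
  have e : I * (sl I z * x) * star c = z.re • (I * x * star c) - z.im • (x * star c) := by
    simp only [sl, add_mul, mul_add, smul_mul_assoc, mul_smul_comm, ← mul_assoc, hI]
    simp only [neg_mul, one_mul, smul_neg, sub_eq_add_neg]
    congr 1
    rw [← Quaternion.coe_commutes, mul_assoc, mul_assoc, Quaternion.coe_mul_eq_smul, ← mul_assoc]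
  have e2 : (sl I z * x) * star c = z.re • (x * star c) + z.im • (I * x * star c) := by
    simp only [sl, add_mul, smul_mul_assoc, mul_assoc, Quaternion.coe_mul_eq_smul]
  rw [LL_apply, LL_apply, e, e2]
  apply Complex.ext <;> simp <;> ring

lemma norm_LL_le {I : H} (hI : I * I = -1) (c x : H) : ‖LL I c x‖ ≤ ‖x‖ * ‖c‖ := by
  obtain ⟨h0, h1, h2⟩ := unit_props hI
  set b := x * star c with hb
  have hbn : ‖b‖ = ‖x‖ * ‖c‖ := by rw [hb, norm_mul, norm_star]
  rw [← hbn]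
  apply le_of_sq_le_sq _ (norm_nonneg _)
  rw [← Complex.normSq_eq_norm_sq, Complex.normSq_apply, LL_apply, mul_assoc, ← hb, sq, ← Quaternion.normSq_eq_norm_mul_self, Quaternion.normSq_def']
  have h3 : I.imI ^ 2 + I.imJ ^ 2 + I.imK ^ 2 = 1 := by
    have := Quaternion.normSq_eq_norm_mul_self I
    rw [Quaternion.normSq_def', h1, h0] at this; linarith
  simp only [Quaternion.re_mul, h0]
  nlinarith [sq_nonneg (I.imI * b.imJ - I.imJ * b.imI), sq_nonneg (I.imI * b.imK - I.imK * b.imI), sq_nonneg (I.imJ * b.imK - I.imK * b.imJ),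
    congrArg (fun t => t * (b.imI^2+b.imJ^2+b.imK^2)) h3]

lemma LL_self {I : H} (hI : I * I = -1) (c : H) : LL I c c = ((‖c‖ ^ 2 : ℝ) : ℂ) := by
  obtain ⟨h0, h1, h2⟩ := unit_props hI
  rw [LL_apply, mul_assoc, Quaternion.self_mul_star, Quaternion.normSq_eq_norm_mul_self]
  apply Complex.ext <;> simp [h0, sq, -Complex.ofReal_mul, -Complex.ofReal_pow]

lemma LL_summ {f : PS} (hf : Conv f) {I : H} (hI : I * I = -1) (c : H) :
    ∀ r : ℝ, 0 ≤ r → r < 1 → Summable fun m => r ^ m * ‖LL I c (coeff m f)‖ := by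
  intro r h0 h1
  rw [conv_iff] at hf
  refine Summable.of_nonneg_of_le (fun m => by positivity) (fun m => ?_) ((hf r h0 h1).mul_right ‖c‖)
  rw [mul_assoc]; gcongr; exact norm_LL_le hI _ _

lemma LL_ev {f : PS} (hf : Conv f) {I : H} (hI : I * I = -1) (c : H) {z : ℂ} (hz : ‖z‖ < 1) :
    ∑' m, z ^ m * LL I c (coeff m f) = LL I c (ev f (sl I z)) := by
  rw [ev, evalC, ContinuousLinearMap.map_tsum _ (hf _ (by rwa [norm_sl hI]))]
  congr 1; ext1 m
  rw [← sl_pow hI, LL_sl hI]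

lemma coeff_bound {f : PS} (hf : Conv f) {M : ℝ} (hM : ∀ q : H, ‖q‖ < 1 → ‖ev f q‖ ≤ M) (m : ℕ) :
    ‖coeff m f‖ ≤ M := by
  obtain ⟨I, -, hI, -⟩ := exists_slice 0
  set c := coeff m f with hc
  have h := cauchy_coeff (fun m => LL I c (coeff m f)) (LL_summ hf hI c) (M * ‖c‖) (fun z hz => by
    rw [LL_ev hf hI c hz]
    refine (norm_LL_le hI _ _).trans ?_
    gcongr; exact hM _ (by rwa [norm_sl hI])) m
  simp only [← hc, LL_self hI] at h
  rw [Complex.norm_real, Real.norm_of_nonneg (by positivity), sq] at h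
  by_cases h0 : ‖c‖ = 0
  · rw [h0]; exact (norm_nonneg _).trans (hM 0 (by simp))
  · exact le_of_mul_le_mul_right h (lt_of_le_of_ne (norm_nonneg _) (Ne.symm h0))

lemma max_principle {φ : ℂ → ℂ} (hφ : DifferentiableOn ℂ φ (Metric.ball 0 1)) {r M : ℝ} (h0 : 0 < r) (h1 : r < 1)
    (hM : ∀ z : ℂ, ‖z‖ = r → ‖φ z‖ ≤ M) {z : ℂ} (hz : ‖z‖ ≤ r) : ‖φ z‖ ≤ M := by
  refine Complex.norm_le_of_forall_mem_frontier_norm_le (U := Metric.ball 0 r) Metric.isBounded_ball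
    ((hφ.mono (?_ : Metric.closedBall (0:ℂ) r ⊆ _)).diffContOnCl_ball subset_rfl) ?_ ?_
  · intro x hx; simp at hx ⊢; linarith
  · intro z hz
    rw [frontier_ball _ h0.ne'] at hz
    exact hM z (by simpa using hz)
  · rw [closure_ball _ h0.ne']; simpa using hz

lemma ev_max {f : PS} (hf : Conv f) {r M : ℝ} (h0 : 0 < r) (h1 : r < 1)
    (hM : ∀ q : H, ‖q‖ = r → ‖ev f q‖ ≤ M) {q : H} (hq : ‖q‖ ≤ r) : ‖ev f q‖ ≤ M := by
  obtain ⟨I, z, hI, rfl⟩ := exists_sl q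
  rw [norm_sl hI] at hq
  set c := ev f (sl I z) with hc
  have h := max_principle (diffOn_tsum _ (LL_summ hf hI c)) h0 h1 (M := M * ‖c‖) (fun w hw => by
    rw [LL_ev hf hI c (by linarith)]
    refine (norm_LL_le hI _ _).trans ?_
    gcongr; exact hM _ (by rwa [norm_sl hI])) hq
  rw [LL_ev hf hI c (by linarith), ← hc, LL_self hI] at h
  rw [Complex.norm_real, Real.norm_of_nonneg (by positivity), sq] at h
  by_cases h2 : ‖c‖ = 0
  · rw [h2]; exact (norm_nonneg _).trans (hM (r : H) (by simp [abs_of_pos h0]))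
  · exact le_of_mul_le_mul_right h (lt_of_le_of_ne (norm_nonneg _) (Ne.symm h2))

lemma LL_const {f : PS} (hf : Schur f) {I c : H} (hI : I * I = -1) (hc : ‖c‖ = 1) {z : ℂ} (hz : ‖z‖ < 1)
    (h : ev f (sl I z) = c) (m : ℕ) : LL I c (coeff m f) = if m = 0 then 1 else 0 := by
  have hL := LL_summ hf.1 hI c
  have h1 : ∀ w : ℂ, ‖w‖ < 1 → ∑' m, w ^ m * LL I c (coeff m f) = 1 := by
    intro w hw
    have := Complex.eqOn_of_isPreconnected_of_isMaxOn_norm (convex_ball (0:ℂ) 1).isPreconnected Metric.isOpen_ball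
      (diffOn_tsum _ hL) (c := z) (by simpa using hz) (by
        intro w hw
        simp only [Set.mem_ofPred_eq, Function.comp]
        have hw : ‖w‖ < 1 := by simpa using hw
        rw [LL_ev hf.1 hI c hw, LL_ev hf.1 hI c hz, h, LL_self hI, hc]
        refine (norm_LL_le hI _ _).trans ?_
        simpa [hc] using hf.2 _ (by rwa [norm_sl hI])) (show w ∈ Metric.ball 0 1 by simpa using hw)
    simp only [Function.const] at this
    rw [this, LL_ev hf.1 hI c hz, h, LL_self hI, hc]; simp
  have h2 := cauchy_coeff (fun m => LL I c (coeff m f) - if m = 0 then 1 else 0) (fun r hr0 hr1 => by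
      refine Summable.of_nonneg_of_le (fun m => by positivity) (fun m => ?_)
        ((hL r hr0 hr1).add (summable_of_ne_finset_zero (s := {0}) (f := fun m => r ^ m * ‖(if m = 0 then 1 else 0 : ℂ)‖) (by
          intro m hm; simp at hm; simp [hm])))
      rw [← mul_add]; gcongr; exact norm_sub_le _ _) 0 (fun w hw => by
      have s1 : Summable fun m => w ^ m * LL I c (coeff m f) := by
        apply Summable.of_norm
        simpa using hL ‖w‖ (norm_nonneg _) hw
      have s2 : HasSum (fun m : ℕ => w ^ m * (if m = 0 then 1 else 0 : ℂ)) 1 := by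
        convert hasSum_single (f := fun m : ℕ => w ^ m * (if m = 0 then 1 else 0 : ℂ)) 0 (by intro m hm; simp [hm]) using 1
        simp
      simp only [mul_sub]
      rw [s1.tsum_sub s2.summable, s2.tsum_eq, h1 w hw]; simp) m
  have := norm_le_zero_iff.1 h2
  exact sub_eq_zero.1 this

lemma schur_const {f : PS} (hf : Schur f) {q : H} (hq : ‖q‖ < 1) (h : ‖ev f q‖ = 1) :
    ∃ u : H, ‖u‖ = 1 ∧ f = C u := by
  have h00 : ev f 0 = coeff 0 f := by
    rw [ev, evalC, tsum_eq_single 0 (by intro m hm; simp [hm])]; simp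
  have hu : ‖coeff 0 f‖ = 1 := by
    obtain ⟨I, z, hI, rfl⟩ := exists_sl q
    rw [norm_sl hI] at hq
    have := LL_const hf hI h hq rfl 0
    have h2 := norm_LL_le hI (ev f (sl I z)) (coeff 0 f)
    rw [this, h] at h2
    have h3 := hf.2 0 (by simp)
    rw [h00] at h3
    simp only [if_true, norm_one, mul_one] at h2
    linarith
  refine ⟨coeff 0 f, hu, ?_⟩
  ext1 m
  rw [coeff_C]
  split_ifs with hm
  · rw [hm]
  · obtain ⟨I, n, hI, -, hx⟩ := exists_slice (coeff m f * star (coeff 0 f))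
    have h2 := LL_const hf hI hu (z := 0) (by simp) (by simp [sl, h00]) m
    rw [if_neg hm, LL_apply, mul_assoc] at h2
    have h3 := congrArg Complex.re h2
    have h4 := congrArg Complex.im h2
    simp only [Complex.zero_re, Complex.zero_im] at h3 h4
    rw [h3] at hx
    rw [hx] at h4
    simp [hI] at h4
    rw [h4] at hx
    simp at hx
    rcases hx with hx | hx
    · exact hx
    · rw [coeff_zero_eq_constantCoeff] at hu; simp [hx] at hu


noncomputable def evA (f : PS) (z : ℂ) : H := ∑' m, (z ^ m).re • coeff m f
noncomputable def evB (f : PS) (z : ℂ) : H := ∑' m, (z ^ m).im • coeff m f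

lemma summ_A {f : PS} (hf : Conv f) {z : ℂ} (hz : ‖z‖ < 1) : Summable fun m => (z ^ m).re • coeff m f := by
  rw [← summable_norm_iff]
  refine Summable.of_nonneg_of_le (fun m => norm_nonneg _) (fun m => ?_) ((conv_iff f).1 hf ‖z‖ (norm_nonneg _) hz)
  rw [norm_smul, ← norm_pow]; gcongr; exact Complex.abs_re_le_norm _
lemma summ_B {f : PS} (hf : Conv f) {z : ℂ} (hz : ‖z‖ < 1) : Summable fun m => (z ^ m).im • coeff m f := by
  rw [← summable_norm_iff]
  refine Summable.of_nonneg_of_le (fun m => norm_nonneg _) (fun m => ?_) ((conv_iff f).1 hf ‖z‖ (norm_nonneg _) hz)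
  rw [norm_smul, ← norm_pow]; gcongr; exact Complex.abs_im_le_norm _

lemma ev_sl {f : PS} (hf : Conv f) {z : ℂ} (hz : ‖z‖ < 1) {I : H} (hI : I * I = -1) :
    ev f (sl I z) = evA f z + I * evB f z := by
  rw [evA, evB, ← (summ_B hf hz).tsum_mul_left, ← (summ_A hf hz).tsum_add ((summ_B hf hz).mul_left I), ev, evalC]
  congr 1; ext1 m
  rw [← sl_pow hI, sl, add_mul, Quaternion.coe_mul_eq_smul, smul_mul_assoc, mul_smul_comm]

noncomputable def Fl (l : H →L[ℝ] ℝ) (f : PS) (z : ℂ) : ℂ := ∑' m, z ^ m * ((l (coeff m f) : ℝ) : ℂ)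

lemma Fl_summ (l : H →L[ℝ] ℝ) {f : PS} (hf : Conv f) : ∀ r : ℝ, 0 ≤ r → r < 1 →
    Summable fun m => r ^ m * ‖((l (coeff m f) : ℝ) : ℂ)‖ := by
  intro r h0 h1
  rw [conv_iff] at hf
  refine Summable.of_nonneg_of_le (fun m => by positivity) (fun m => ?_) ((hf r h0 h1).mul_left ‖l‖)
  rw [Complex.norm_real, mul_left_comm]; gcongr; exact l.le_opNorm _

lemma Fl_eq (l : H →L[ℝ] ℝ) {f : PS} (hf : Conv f) {z : ℂ} (hz : ‖z‖ < 1) :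
    Fl l f z = ⟨l (evA f z), l (evB f z)⟩ := by
  have s : Summable fun m => z ^ m * ((l (coeff m f) : ℝ) : ℂ) := by
    apply Summable.of_norm
    simpa using Fl_summ l hf ‖z‖ (norm_nonneg _) hz
  apply Complex.ext
  · rw [Fl, Complex.re_tsum s, evA, l.map_tsum (summ_A hf hz)]
    simp
  · rw [Fl, Complex.im_tsum s, evB, l.map_tsum (summ_B hf hz)]
    simp

noncomputable def l0 : H →L[ℝ] ℝ := LinearMap.toContinuousLinearMap
  { toFun := fun x => x.re, map_add' := fun x y => by simp, map_smul' := fun r x => by simp }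
noncomputable def l1 : H →L[ℝ] ℝ := LinearMap.toContinuousLinearMap
  { toFun := fun x => x.imI, map_add' := fun x y => by simp, map_smul' := fun r x => by simp }
noncomputable def l2 : H →L[ℝ] ℝ := LinearMap.toContinuousLinearMap
  { toFun := fun x => x.imJ, map_add' := fun x y => by simp, map_smul' := fun r x => by simp }
noncomputable def l3 : H →L[ℝ] ℝ := LinearMap.toContinuousLinearMap
  { toFun := fun x => x.imK, map_add' := fun x y => by simp, map_smul' := fun r x => by simp }

/-- the symmetrization on the complex disc -/
noncomputable def sy (f : PS) (z : ℂ) : ℂ := Fl l0 f z ^ 2 + Fl l1 f z ^ 2 + Fl l2 f z ^ 2 + Fl l3 f z ^ 2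

lemma sy_diff {f : PS} (hf : Conv f) : DifferentiableOn ℂ (sy f) (Metric.ball 0 1) := by
  have h := fun l => diffOn_tsum _ (Fl_summ l hf)
  exact ((((h l0).pow 2).add ((h l1).pow 2)).add ((h l2).pow 2)).add ((h l3).pow 2)

lemma quat_pair (A B : H) : ∃ I J : H, I * I = -1 ∧ J * J = -1 ∧
    ‖A + I * B‖ ^ 2 * ‖A + J * B‖ ^ 2 =
      (‖A‖ ^ 2 - ‖B‖ ^ 2) ^ 2 + (2 * (A * star B).re) ^ 2 := by
  obtain ⟨I, n, hI, -, hx⟩ := exists_slice (A * star B)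
  obtain ⟨h0, h1, h2⟩ := unit_props hI
  refine ⟨I, -I, hI, by simpa using hI, ?_⟩
  set ρ := (A * star B).re
  have e : (A * star (I * B)).re = n := by
    rw [star_mul, ← mul_assoc, hx, h2]
    simp [add_mul, hI, h0]
  have en : ‖A‖ ^ 2 * ‖B‖ ^ 2 = ρ ^ 2 + n ^ 2 := by
    have h3 : ‖A * star B‖ = ‖sl I ⟨ρ, n⟩‖ := by rw [hx]; rfl
    rw [norm_sl hI, norm_mul, norm_star] at h3
    rw [← mul_pow, h3, Complex.sq_norm, Complex.normSq_apply]; ring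
  have q1 : ‖A + I * B‖ ^ 2 = ‖A‖ ^ 2 + ‖B‖ ^ 2 + 2 * n := by
    rw [sq, ← Quaternion.normSq_eq_norm_mul_self, Quaternion.normSq_add, e]
    simp only [Quaternion.normSq_eq_norm_mul_self, norm_mul, h1]; ring
  have q2 : ‖A + -I * B‖ ^ 2 = ‖A‖ ^ 2 + ‖B‖ ^ 2 - 2 * n := by
    rw [sq, ← Quaternion.normSq_eq_norm_mul_self, Quaternion.normSq_add, neg_mul, star_neg, mul_neg, Quaternion.re_neg, e]
    simp only [Quaternion.normSq_eq_norm_mul_self, norm_mul, norm_neg, h1]; ring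
  rw [q1, q2]
  linear_combination 4 * en

lemma sy_norm {f : PS} (hf : Conv f) {z : ℂ} (hz : ‖z‖ < 1) : ∃ p q : H, ‖p‖ = ‖z‖ ∧ ‖q‖ = ‖z‖ ∧
    ‖sy f z‖ = ‖ev f p‖ * ‖ev f q‖ := by
  obtain ⟨I, J, hI, hJ, h⟩ := quat_pair (evA f z) (evB f z)
  refine ⟨sl I z, sl J z, norm_sl hI z, norm_sl hJ z, ?_⟩
  have : ‖sy f z‖ ^ 2 = (‖ev f (sl I z)‖ * ‖ev f (sl J z)‖) ^ 2 := by
    rw [mul_pow, ev_sl hf hz hI, ev_sl hf hz hJ, h, Complex.sq_norm, Complex.normSq_apply, sy, Fl_eq l0 hf hz, Fl_eq l1 hf hz, Fl_eq l2 hf hz, Fl_eq l3 hf hz]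
    generalize evA f z = A
    generalize evB f z = B
    rw [sq ‖A‖, sq ‖B‖, ← Quaternion.normSq_eq_norm_mul_self, ← Quaternion.normSq_eq_norm_mul_self, Quaternion.normSq_def', Quaternion.normSq_def']
    have e0 : ∀ x, l0 x = x.re := fun _ => rfl
    have e1 : ∀ x, l1 x = x.imI := fun _ => rfl
    have e2 : ∀ x, l2 x = x.imJ := fun _ => rfl
    have e3 : ∀ x, l3 x = x.imK := fun _ => rfl
    simp [sq, e0, e1, e2, e3]
    ring
  exact (pow_left_inj₀ (norm_nonneg _) (by positivity) two_ne_zero).1 this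

def Inn (f : PS) : Prop := ∃ K : ℝ, ∀ q : H, ‖q‖ < 1 → 1 - ‖ev f q‖ ^ 2 ≤ K * (1 - ‖q‖ ^ 2)

lemma exists_zero {f : PS} (hf : Conv f) (h1 : ∀ q : H, ‖q‖ < 1 → ‖ev f q‖ < 1) (hi : Inn f) :
    ∃ t : H, ‖t‖ < 1 ∧ ev f t = 0 := by
  by_contra! hne
  obtain ⟨K, hK⟩ := hi
  have hs0 : ∀ z : ℂ, ‖z‖ < 1 → sy f z ≠ 0 := by
    intro z hz
    obtain ⟨p, q, hp, hq, h⟩ := sy_norm hf hz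
    have : 0 < ‖sy f z‖ := by
      rw [h]
      have := norm_pos_iff.2 (hne p (by linarith))
      have := norm_pos_iff.2 (hne q (by linarith))
      positivity
    exact norm_pos_iff.1 this
  have hd : DifferentiableOn ℂ (fun z => (sy f z)⁻¹) (Metric.ball 0 1) :=
    (sy_diff hf).fun_inv (fun z hz => hs0 z (by simpa using hz))
  have key : ∀ r : ℝ, 0 < r → r < 1 → 0 < 1 - K * (1 - r ^ 2) → 1 - K * (1 - r ^ 2) ≤ ‖sy f 0‖ := by
    intro r hr0 hr1 hpos
    have := max_principle hd hr0 hr1 (M := (1 - K * (1 - r ^ 2))⁻¹) (fun z hz => by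
      rw [norm_inv]
      apply inv_anti₀ hpos
      obtain ⟨p, q, hp, hq, h⟩ := sy_norm hf (z := z) (by linarith)
      rw [h]
      have a1 := hK p (by linarith)
      have a2 := hK q (by linarith)
      rw [hp, hz] at a1
      rw [hq, hz] at a2
      apply le_of_sq_le_sq _ (by positivity)
      rw [mul_pow, sq (1 - _)]
      exact mul_le_mul (by linarith) (by linarith) hpos.le (by positivity)) (z := 0) (by simpa using hr0.le)
    rw [norm_inv] at this
    exact (inv_le_inv₀ (norm_pos_iff.2 (hs0 0 (by simp))) hpos).1 this
  have ht : Filter.Tendsto (fun r : ℝ => 1 - K * (1 - r ^ 2)) (nhdsWithin 1 (Set.Iio 1)) (nhds 1) := by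
    have : Filter.Tendsto (fun r : ℝ => 1 - K * (1 - r ^ 2)) (nhds 1) (nhds (1 - K * (1 - 1 ^ 2))) :=
      Continuous.tendsto (by fun_prop) 1
    simp at this
    exact this.mono_left nhdsWithin_le_nhds
  have h1le : 1 ≤ ‖sy f 0‖ := by
    refine le_of_tendsto ht ?_
    filter_upwards [Ioo_mem_nhdsLT (show (0:ℝ) < 1 by norm_num), ht.eventually (lt_mem_nhds (show (0:ℝ) < 1 by norm_num))] with r hr hr'
    exact key r hr.1 hr.2 hr'
  obtain ⟨p, q, hp, hq, h⟩ := sy_norm hf (z := 0) (by simp)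
  have a1 := h1 p (by rw [hp]; simp)
  have a2 := h1 q (by rw [hq]; simp)
  rw [h] at h1le
  nlinarith [norm_nonneg (ev f p), norm_nonneg (ev f q)]

noncomputable def lin (t : H) : PS := 1 - X * C (star t)
noncomputable def xm (t : H) : PS := X - C t

lemma lin_poly (t : H) : IsPoly 1 (lin t) := (isPoly_one.mono (by omega)).sub (isPoly_X.mul (isPoly_C _))
lemma xm_poly (t : H) : IsPoly 1 (xm t) := isPoly_X.sub ((isPoly_C _).mono (by omega))
lemma conv_lin (t : H) : Conv (lin t) := (lin_poly t).conv
lemma conv_xm (t : H) : Conv (xm t) := (xm_poly t).conv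
lemma coeff_XC (m : ℕ) (c : H) : coeff m (X * C c : PS) = if m = 1 then c else 0 := by
  rw [coeff_mul_C, coeff_X]; split_ifs <;> simp
lemma ev_lin (t q : H) : ev (lin t) q = 1 - q * star t := by
  rw [(lin_poly t).ev]; simp [lin, Finset.sum_range_succ, coeff_XC, coeff_one]; rfl
lemma ev_xm (t q : H) : ev (xm t) q = q - t := by
  rw [(xm_poly t).ev]; simp [xm, Finset.sum_range_succ, coeff_X, coeff_C]; abel
lemma xm_ne (t : H) : xm t ≠ 0 := by
  intro h
  have := congrArg (coeff 1) h
  simp [xm, coeff_X, coeff_C] at this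
lemma lin_ne (t : H) : lin t ≠ 0 := by
  intro h
  have := congrArg (coeff 0) h
  simp [lin] at this
lemma xm_lin (t : H) : xm t * lin t = lin t * xm t := by
  have h : (C t : PS) * C (star t) = C (star t) * C t := by
    rw [← map_mul, ← map_mul]; congr 1
    exact (Quaternion.self_mul_star t).trans (Quaternion.star_mul_self t).symm
  have e1 : (C t : PS) * X = X * C t := (X_mul).symm
  have e2 : (C (star t) : PS) * X = X * C (star t) := (X_mul).symm
  simp only [xm, lin, mul_sub, sub_mul, mul_one, one_mul]
  have e3 : (C t : PS) * (X * C (star t)) = X * C (star t) * C t := by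
    rw [← mul_assoc, e1, mul_assoc, h, mul_assoc]
  have e4 : (X : PS) * C (star t) * X = X * (X * C (star t)) := by rw [mul_assoc, e2]
  rw [e3, e4]; abel

/-- two-sided inverse -/
lemma inv_comm {U V : PS} (h : U * V = 1) : V * U = 1 := by
  have hV : U ≠ 0 := by rintro rfl; simp at h
  apply mul_left_cancel₀ hV
  rw [← mul_assoc, h, one_mul, mul_one]

/-! difference quotient -/
noncomputable def dq (f : PS) (p : H) : PS := PowerSeries.mk (diffQuotC (fun m => coeff m f) p)

lemma summ_shift {f : PS} (hf : Conv f) {p : H} (hp : ‖p‖ < 1) (m : ℕ) : Summable fun k => p ^ k * coeff (k + m) f := by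
  rw [conv_iff] at hf
  rw [← summable_norm_iff]
  set r := (1 + ‖p‖)/2
  have h0 : 0 < r := by positivity
  have h1 : r < 1 := by simp only [r]; linarith
  have h2 : ‖p‖ ≤ r := by simp only [r]; linarith
  have h3 := ((summable_nat_add_iff m).2 (hf r h0.le h1)).mul_left ((r ^ m)⁻¹)
  refine Summable.of_nonneg_of_le (fun _ => norm_nonneg _) (fun k => ?_) h3
  rw [norm_mul, norm_pow, pow_add]
  have : (r ^ m)⁻¹ * (r ^ k * r ^ m * ‖coeff (k + m) f‖) = r ^ k * ‖coeff (k+m) f‖ := by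
    field_simp
  rw [this]; gcongr

lemma dq_eq {f : PS} (hf : Conv f) {p : H} (hp : ‖p‖ < 1) : f = C (ev f p) + xm p * dq f p := by
  ext1 m
  rw [map_add, xm, sub_mul, map_sub, coeff_C_mul, coeff_C]
  have key : ∀ m, (∑' k, p ^ k * coeff (k + m) f) = coeff m f + p * ∑' k, p ^ k * coeff (k + m + 1) f := by
    intro m
    rw [(summ_shift hf hp m).tsum_eq_zero_add, ← tsum_mul_left]
    simp only [pow_zero, one_mul, zero_add]
    congr 2; ext1 k
    rw [pow_succ', mul_assoc, show k + 1 + m = k + m + 1 by ring]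
  cases m with
  | zero =>
    have : coeff 0 (X * dq f p) = 0 := by simp
    rw [this, if_pos rfl]
    have := key 0
    simp only [add_zero] at this
    simp only [ev, evalC, this, dq, coeff_mk, diffQuotC]
    simp
  | succ m =>
    rw [coeff_succ_X_mul, if_neg (by omega)]
    simp only [dq, coeff_mk, diffQuotC]
    have := key (m+1)
    simp only [← add_assoc] at this ⊢
    rw [this]; abel

lemma conv_dq {f : PS} (hf : Conv f) {p : H} (hp : ‖p‖ < 1) : Conv (dq f p) := by
  rw [conv_iff] at *
  intro r h0 h1
  obtain ⟨s, hs, hs1⟩ := exists_between (max_lt h1 hp)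
  have hrs : r < s := (le_max_left _ _).trans_lt hs
  have hps : ‖p‖ < s := (le_max_right _ _).trans_lt hs
  have hs0 : 0 < s := h0.trans_lt hrs
  have hsum := hf s hs0.le hs1
  set K := ∑' m, s ^ m * ‖coeff m f‖ with hK
  have hK0 : 0 ≤ K := tsum_nonneg (fun m => by positivity)
  have hb : ∀ m, ‖coeff m f‖ ≤ K * (s⁻¹) ^ m := by
    intro m
    have := hsum.le_tsum m (fun j _ => by positivity)
    rw [inv_pow, ← div_eq_mul_inv, le_div_iff₀ (by positivity), mul_comm]; exact this
  have hg : ‖p‖ * s⁻¹ < 1 := by rw [← div_eq_mul_inv, div_lt_one hs0]; exact hps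
  have hgs := summable_geometric_of_lt_one (by positivity) hg
  have hr' : r * s⁻¹ < 1 := by rw [← div_eq_mul_inv, div_lt_one hs0]; exact hrs
  refine Summable.of_nonneg_of_le (fun m => by positivity) (fun m => ?_)
    ((summable_geometric_of_lt_one (by positivity) hr').mul_right (K * s⁻¹ * ∑' k, (‖p‖ * s⁻¹) ^ k))
  have : ‖coeff m (dq f p)‖ ≤ K * (s⁻¹)^(m+1) * ∑' k, (‖p‖ * s⁻¹) ^ k := by
    simp only [dq, coeff_mk, diffQuotC]
    refine tsum_of_norm_bounded (hgs.hasSum.mul_left _) (fun k => ?_)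
    rw [norm_mul, norm_pow]
    calc _ ≤ ‖p‖ ^ k * (K * (s⁻¹) ^ (k + m + 1)) := by gcongr; exact hb _
      _ = _ := by rw [mul_pow, pow_add, pow_add, pow_add]; ring
  calc _ ≤ r ^ m * (K * (s⁻¹)^(m+1) * ∑' k, (‖p‖ * s⁻¹) ^ k) := by gcongr
    _ = _ := by rw [mul_pow, pow_succ]; ring

lemma factor_zero {f : PS} (hf : Conv f) {p : H} (hp : ‖p‖ < 1) (h : ev f p = 0) : f = xm p * dq f p := by
  have := dq_eq hf hp
  rw [h] at this; simpa using this

lemma factor_poly {k : ℕ} {f : PS} (hf : IsPoly (k+1) f) {p : H} : IsPoly k (dq f p) := by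
  intro m hm
  simp only [dq, coeff_mk, diffQuotC]
  have : (fun j => p ^ j * coeff (j + m + 1) f) = fun _ => 0 := by
    ext1 j; rw [hf _ (by omega), mul_zero]
  rw [this, tsum_zero]

/-! inverse lemma -/
lemma ev_pow_le {φ : PS} (hφ : Conv φ) {c : ℝ} (h : ∀ q : H, ‖q‖ < 1 → ‖ev φ q‖ ≤ c) (n : ℕ) :
    Conv (φ ^ n) ∧ ∀ q : H, ‖q‖ < 1 → ‖ev (φ ^ n) q‖ ≤ c ^ n := by
  have hc : 0 ≤ c := (norm_nonneg _).trans (h 0 (by simp))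
  induction n with
  | zero => 
    rw [pow_zero]; exact ⟨conv_one, fun q _ => by simp [ev_one]⟩
  | succ n ih =>
    rw [pow_succ]
    refine ⟨ih.1.mul hφ, fun q hq => ?_⟩
    rw [ev_mul ih.1 hφ hq, norm_mul, pow_succ]
    exact mul_le_mul (ih.2 q hq) (h _ (norm_cj_lt _ hq)) (norm_nonneg _) (by positivity)

lemma conv_inv {φ V : PS} (hφ : Conv φ) {c : ℝ} (hc : c < 1) (h : ∀ q : H, ‖q‖ < 1 → ‖ev φ q‖ ≤ c)
    (hV : (1 - φ) * V = 1) : Conv V := by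
  have hc0 : 0 ≤ c := (norm_nonneg _).trans (h 0 (by simp))
  have hcb : ∀ n m, ‖coeff m (φ ^ n)‖ ≤ c ^ n := fun n m =>
    coeff_bound (ev_pow_le hφ h n).1 (ev_pow_le hφ h n).2 m
  have hV' : V = 1 + V * φ := by
    have := inv_comm hV
    rw [mul_sub, mul_one, sub_eq_iff_eq_add] at this
    exact this
  have hN : ∀ N, V = ∑ n ∈ Finset.range N, φ ^ n + V * φ ^ N := by
    intro N
    induction N with
    | zero => simp
    | succ N ih =>
      rw [Finset.sum_range_succ, pow_succ', ← mul_assoc]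
      conv_lhs => rw [ih]
      have : V * φ ^ N = φ ^ N + V * φ * φ ^ N := by
        conv_lhs => rw [hV', add_mul, one_mul]
      rw [this]; abel
  refine conv_of_bdd (K := (1 - c)⁻¹) (fun m => ?_)
  set S := ∑ x ∈ Finset.HasAntidiagonal.antidiagonal m, ‖coeff x.1 V‖
  have hle : ∀ N : ℕ, ‖coeff m V‖ ≤ (1 - c)⁻¹ + S * c ^ N := by
    intro N
    have h1 := congrArg (coeff m) (hN N)
    rw [h1, map_add, map_sum]
    refine (norm_add_le _ _).trans (add_le_add ?_ ?_)
    · refine (norm_sum_le _ _).trans ?_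
      refine (Finset.sum_le_sum (fun n _ => hcb n m)).trans ?_
      rw [← tsum_geometric_of_lt_one hc0 hc]
      exact (summable_geometric_of_lt_one hc0 hc).sum_le_tsum _ (fun _ _ => by positivity)
    · rw [coeff_mul]
      refine (norm_sum_le _ _).trans ?_
      rw [Finset.sum_mul]
      refine Finset.sum_le_sum (fun x _ => ?_)
      rw [norm_mul]; gcongr; exact hcb _ _
  have hlim : Filter.Tendsto (fun N : ℕ => (1 - c)⁻¹ + S * c ^ N) Filter.atTop (nhds ((1-c)⁻¹ + S * 0)) :=
    ((tendsto_pow_atTop_nhds_zero_of_lt_one hc0 hc).const_mul S).const_add _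
  rw [mul_zero, add_zero] at hlim
  exact ge_of_tendsto' hlim hle

noncomputable def inv (f : PS) : PS := PowerSeries.mk (starInvC (fun m => coeff m f))

lemma mk_starMul (a b : ℕ → H) : PowerSeries.mk (starMulC a b) = PowerSeries.mk a * PowerSeries.mk b := by
  ext1 m
  rw [coeff_mul, coeff_mk, starMulC, Finset.Nat.sum_antidiagonal_eq_sum_range_succ_mk, ← Finset.sum_range_reflect]
  apply Finset.sum_congr rfl
  intro i hi
  simp only [Finset.mem_range] at hi
  simp only [coeff_mk]
  congr 2 <;> omega

lemma mul_inv' {f : PS} (h : coeff 0 f ≠ 0) : f * inv f = 1 := by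
  have e : f = PowerSeries.mk (fun m => coeff m f) := by ext1 m; simp
  conv_lhs => rw [e]
  rw [← e, inv]
  conv_lhs => rw [e]
  simp only [coeff_mk]
  rw [← mk_starMul]
  ext1 m
  rw [coeff_mk, starMulC]
  cases m with
  | zero => rw [coeff_one]; simp [starInvC]; exact mul_inv_cancel₀ (by simpa using h)
  | succ m =>
    rw [Finset.sum_range_succ, coeff_one, if_neg (by omega), starInvC, ← Finset.sum_range (fun l => coeff (m + 1 - l) f * starInvC (fun m => coeff m f) l)]
    rw [Nat.sub_self, ← mul_assoc, mul_neg, mul_inv_cancel₀ h]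
    simp

lemma inv_mul' {f : PS} (h : coeff 0 f ≠ 0) : inv f * f = 1 := inv_comm (mul_inv' h)

/-- evaluate an inverse -/
lemma ev_inv_mul {U V e : PS} (hU : Conv U) (hV : Conv V) (he : Conv e) (h : V * U = 1) {x : H} (hx : ‖x‖ < 1) :
    ∃ q : H, ‖q‖ = ‖x‖ ∧ ev U q ≠ 0 ∧ ev (V * e) x = (ev U q)⁻¹ * ev e q := by
  have h1 := ev_mul hV hU hx
  rw [h, ev_one] at h1
  have h2 : ev V x ≠ 0 := by intro h0; rw [h0] at h1; simp at h1
  refine ⟨cj (ev V x) x, norm_cj h2 x, ?_, ?_⟩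
  · intro h0; rw [h0] at h1; simp at h1
  · rw [ev_mul hV he hx]; congr 1
    exact eq_inv_of_mul_eq_one_left h1.symm

lemma coeff_lin (t : H) : coeff 0 (lin t) = 1 := by simp [lin]

lemma conv_inv_lin {t : H} (ht : ‖t‖ < 1) : Conv (inv (lin t)) := by
  have h := mul_inv' (f := lin t) (by simp [coeff_lin])
  refine conv_inv (φ := X * C (star t)) (conv_X.mul (conv_C _)) (c := ‖t‖) ht ?_ h
  intro q hq
  rw [ev_mul conv_X (conv_C _) hq, ev_X, ev_C, norm_mul, norm_star]
  nlinarith [norm_nonneg t]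

/-- norm identity -/
lemma nid (a w : H) : ‖1 - a * star w‖ ^ 2 - ‖a - w‖ ^ 2 = (1 - ‖a‖ ^ 2) * (1 - ‖w‖ ^ 2) := by
  simp only [sq, ← Quaternion.normSq_eq_norm_mul_self, Quaternion.normSq_def', Quaternion.re_sub, Quaternion.imI_sub, Quaternion.imJ_sub, Quaternion.imK_sub, Quaternion.re_mul, Quaternion.imI_mul, Quaternion.imJ_mul, Quaternion.imK_mul, Quaternion.re_star, Quaternion.imI_star, Quaternion.imJ_star, Quaternion.imK_star, one_re', one_imI', one_imJ', one_imK']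
  ring

noncomputable def Mb (t : H) : PS := inv (lin t) * xm t
lemma conv_Mb {t : H} (ht : ‖t‖ < 1) : Conv (Mb t) := (conv_inv_lin ht).mul (conv_xm t)
lemma lin_Mb (t : H) : lin t * Mb t = xm t := by
  rw [Mb, ← mul_assoc, mul_inv' (by simp [coeff_lin]), one_mul]
lemma Mb_lin (t : H) : Mb t * lin t = xm t := by
  apply mul_left_cancel₀ (lin_ne t)
  rw [← mul_assoc, lin_Mb, xm_lin]

lemma sq_bd {w q : H} (hw : ‖w‖ < 1) (hq : ‖q‖ < 1) : 0 < ‖1 - q * star w‖ ∧ (1 - ‖w‖) ≤ ‖1 - q * star w‖ := by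
  have h := norm_sub_norm_le (1 : H) (q * star w)
  rw [norm_one, norm_mul, norm_star] at h
  have : ‖q‖ * ‖w‖ ≤ ‖w‖ := by nlinarith [norm_nonneg w]
  constructor <;> linarith

/-- general Moebius fraction estimate -/
lemma frac (w y : H) (hw : ‖w‖ < 1) (hy : ‖1 - y * star w‖ ≠ 0) :
    1 - ‖(1 - y * star w)⁻¹ * (y - w)‖ ^ 2 = (1 - ‖y‖ ^ 2) * (1 - ‖w‖ ^ 2) / ‖1 - y * star w‖ ^ 2 := by
  rw [norm_mul, norm_inv, ← nid]; field_simp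

lemma Mb_ev {t : H} (ht : ‖t‖ < 1) {q : H} (hq : ‖q‖ < 1) : ∃ y : H, ‖y‖ = ‖q‖ ∧
    1 - ‖ev (Mb t) q‖ ^ 2 = (1 - ‖q‖ ^ 2) * (1 - ‖t‖ ^ 2) / ‖1 - y * star t‖ ^ 2 := by
  obtain ⟨y, hy, h0, h1⟩ := ev_inv_mul (conv_lin t) (conv_inv_lin ht) (conv_xm t) (inv_mul' (by simp [coeff_lin])) hq
  refine ⟨y, hy, ?_⟩
  rw [ev_lin] at h0
  rw [Mb, h1, ev_lin, ev_xm, frac _ _ ht (by simpa using h0), hy]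

lemma schur_of {f : PS} (hf : Conv f) (h : ∀ q : H, ‖q‖ < 1 → 0 ≤ 1 - ‖ev f q‖ ^ 2) : Schur f :=
  ⟨hf, fun q hq => by have := h q hq; nlinarith [norm_nonneg (ev f q)]⟩

lemma sq_pos' {q : H} (hq : ‖q‖ < 1) : 0 < 1 - ‖q‖ ^ 2 := by nlinarith [norm_nonneg q]

lemma Mb_schur {t : H} (ht : ‖t‖ < 1) : Schur (Mb t) := by
  refine schur_of (conv_Mb ht) (fun q hq => ?_)
  obtain ⟨y, hy, h⟩ := Mb_ev ht hq
  rw [h]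
  have := sq_pos' ht
  have := sq_pos' hq
  positivity

lemma Mb_inn {t : H} (ht : ‖t‖ < 1) : Inn (Mb t) := by
  refine ⟨(1 - ‖t‖ ^ 2) / (1 - ‖t‖) ^ 2, fun q hq => ?_⟩
  obtain ⟨y, hy, h⟩ := Mb_ev ht hq
  have h1 := sq_pos' ht
  have h2 := sq_pos' hq
  have h3 := sq_bd ht (q := y) (by rwa [hy])
  have h4 : 0 < 1 - ‖t‖ := by linarith
  rw [h, mul_comm (1 - ‖q‖ ^ 2), mul_div_right_comm]
  gcongr; exact h3.2

lemma Schur.mul {f g : PS} (hf : Schur f) (hg : Schur g) : Schur (f * g) :=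
  ⟨hf.1.mul hg.1, fun q hq => by
    rw [ev_mul hf.1 hg.1 hq, norm_mul]
    have h1 := hf.2 q hq
    have h2 := hg.2 _ (norm_cj_lt (ev f q) hq)
    exact mul_le_one₀ h1 (norm_nonneg _) h2⟩

lemma Inn.nonneg {f : PS} (h : Inn f) : ∃ K : ℝ, 0 ≤ K ∧ ∀ q : H, ‖q‖ < 1 → 1 - ‖ev f q‖ ^ 2 ≤ K * (1 - ‖q‖ ^ 2) := by
  obtain ⟨K, h⟩ := h
  refine ⟨max K 0, le_max_right _ _, fun q hq => (h q hq).trans ?_⟩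
  have := sq_pos' hq
  gcongr; exact le_max_left _ _

lemma Inn.mul {f g : PS} (hf : Schur f) (hg : Schur g) (h1 : Inn f) (h2 : Inn g) : Inn (f * g) := by
  obtain ⟨K, hK0, hK⟩ := h1.nonneg
  obtain ⟨L, hL0, hL⟩ := h2.nonneg
  refine ⟨K + L + 1, fun q hq => ?_⟩
  rw [ev_mul hf.1 hg.1 hq, norm_mul, mul_pow]
  have a1 := hf.2 q hq
  have a2 := hK q hq
  have a3 := sq_pos' hq
  by_cases h0 : ev f q = 0
  · rw [h0] at a2 ⊢; simp at a2 ⊢; nlinarith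
  · have b1 := hg.2 _ (norm_cj_lt (ev f q) hq)
    have b2 := hL _ (norm_cj_lt (ev f q) hq)
    rw [norm_cj h0] at b2
    set A := ‖ev f q‖
    set B := ‖ev g (cj (ev f q) q)‖
    have : 1 - A ^ 2 * B ^ 2 = (1 - A^2) + A ^ 2 * (1 - B ^ 2) := by ring
    rw [this]
    have hA : A ^ 2 ≤ 1 := by have : 0 ≤ A := norm_nonneg _; nlinarith
    have hB : 0 ≤ 1 - B ^ 2 := by have : 0 ≤ B := norm_nonneg _; nlinarith
    nlinarith


lemma C_comm (w : H) : (C w : PS) * C (star w) = C (star w) * C w := by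
  rw [← map_mul, ← map_mul]; congr 1
  exact (Quaternion.self_mul_star w).trans (Quaternion.star_mul_self w).symm

noncomputable def U1 (w : H) (f : PS) : PS := 1 - f * C (star w)
noncomputable def U2 (w : H) (f : PS) : PS := 1 - C (star w) * f
noncomputable def bul (w : H) (f : PS) : PS := inv (U1 w f) * (f - C w)

lemma c0_le {f : PS} (hf : Schur f) : ‖coeff 0 f‖ ≤ 1 := coeff_bound hf.1 hf.2 0

lemma ev_phi1 {f : PS} (hf : Schur f) (w : H) {q : H} (hq : ‖q‖ < 1) : ‖ev (f * C (star w)) q‖ ≤ ‖w‖ := by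
  rw [ev_mul hf.1 (conv_C _) hq, ev_C, norm_mul, norm_star]
  exact mul_le_of_le_one_left (norm_nonneg _) (hf.2 q hq)
lemma ev_phi2 {f : PS} (hf : Schur f) (w : H) {q : H} (hq : ‖q‖ < 1) : ‖ev (C (star w) * f) q‖ ≤ ‖w‖ := by
  rw [ev_mul (conv_C _) hf.1 hq, ev_C, norm_mul, norm_star]
  exact mul_le_of_le_one_right (norm_nonneg _) (hf.2 _ (norm_cj_lt _ hq))

lemma ne_of_lt1 {x : H} (h : ‖x‖ < 1) : 1 - x ≠ 0 := by
  intro h0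
  rw [sub_eq_zero] at h0
  rw [← h0, norm_one] at h; exact lt_irrefl _ h

lemma U1_c {f : PS} (hf : Schur f) {w : H} (hw : ‖w‖ < 1) : coeff 0 (U1 w f) ≠ 0 := by
  rw [U1, map_sub, coeff_mul_C, coeff_one, if_pos rfl]
  apply ne_of_lt1
  rw [norm_mul, norm_star]
  exact (mul_le_of_le_one_left (norm_nonneg _) (c0_le hf)).trans_lt hw
lemma U2_c {f : PS} (hf : Schur f) {w : H} (hw : ‖w‖ < 1) : coeff 0 (U2 w f) ≠ 0 := by
  rw [U2, map_sub, coeff_C_mul, coeff_one, if_pos rfl]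
  apply ne_of_lt1
  rw [norm_mul, norm_star]
  exact (mul_le_of_le_one_right (norm_nonneg _) (c0_le hf)).trans_lt hw

lemma conv_U1 {f : PS} (hf : Schur f) (w : H) : Conv (U1 w f) := conv_one.sub (hf.1.mul (conv_C _))
lemma conv_inv_U1 {f : PS} (hf : Schur f) {w : H} (hw : ‖w‖ < 1) : Conv (inv (U1 w f)) :=
  conv_inv (hf.1.mul (conv_C _)) hw (fun _ hq => ev_phi1 hf w hq) (mul_inv' (U1_c hf hw))
lemma conv_inv_U2 {f : PS} (hf : Schur f) {w : H} (hw : ‖w‖ < 1) : Conv (inv (U2 w f)) :=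
  conv_inv ((conv_C _).mul hf.1) hw (fun _ hq => ev_phi2 hf w hq) (mul_inv' (U2_c hf hw))

lemma U12 (w : H) (f : PS) : (f - C w) * U2 w f = U1 w f * (f - C w) := by
  simp only [U1, U2, mul_sub, sub_mul, mul_one, one_mul]
  have : (C w : PS) * (C (star w) * f) = f * C (star w) * C w := by
    rw [← mul_assoc, mul_assoc f, ← C_comm, ← map_mul, Quaternion.self_mul_star]
    ext1 m
    rw [coeff_C_mul, coeff_mul_C]
    exact (Quaternion.coe_commutes _ _)
  rw [this]; simp only [mul_assoc]; abel

lemma bul_eq {f : PS} (hf : Schur f) {w : H} (hw : ‖w‖ < 1) : bul w f = (f - C w) * inv (U2 w f) := by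
  have h1 := inv_mul' (U1_c hf hw)
  have h2 := mul_inv' (U2_c hf hw)
  rw [bul]
  calc _ = inv (U1 w f) * (f - C w) * (U2 w f * inv (U2 w f)) := by rw [h2, mul_one]
    _ = inv (U1 w f) * ((f - C w) * U2 w f) * inv (U2 w f) := by simp only [mul_assoc]
    _ = _ := by rw [U12, ← mul_assoc, h1, one_mul]

lemma conv_bul {f : PS} (hf : Schur f) {w : H} (hw : ‖w‖ < 1) : Conv (bul w f) :=
  (conv_inv_U1 hf hw).mul (hf.1.sub (conv_C _))

lemma sq_bd' {w q : H} (hw : ‖w‖ < 1) (hq : ‖q‖ ≤ 1) : 0 < ‖1 - q * star w‖ ∧ (1 - ‖w‖) ≤ ‖1 - q * star w‖ := by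
  have h := norm_sub_norm_le (1 : H) (q * star w)
  rw [norm_one, norm_mul, norm_star] at h
  have : ‖q‖ * ‖w‖ ≤ ‖w‖ := by nlinarith [norm_nonneg w]
  constructor <;> linarith

lemma bul_ev {f : PS} (hf : Schur f) {w : H} (hw : ‖w‖ < 1) {x : H} (hx : ‖x‖ < 1) : ∃ y : H, ‖y‖ = ‖x‖ ∧
    1 - ‖ev (bul w f) x‖ ^ 2 = (1 - ‖ev f y‖ ^ 2) * (1 - ‖w‖ ^ 2) / ‖1 - ev f y * star w‖ ^ 2 := by
  obtain ⟨y, hy, h0, h1⟩ := ev_inv_mul (conv_U1 hf w) (conv_inv_U1 hf hw) (hf.1.sub (conv_C w)) (inv_mul' (U1_c hf hw)) hx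
  have hy1 : ‖y‖ < 1 := by rwa [hy]
  have e1 : ev (U1 w f) y = 1 - ev f y * star w := by
    rw [U1, ev_sub conv_one (hf.1.mul (conv_C _)) hy1, ev_one, ev_mul hf.1 (conv_C _) hy1, ev_C]
  refine ⟨y, hy, ?_⟩
  rw [bul, h1, e1, ev_sub hf.1 (conv_C _) hy1, ev_C, frac _ _ hw]
  rw [e1] at h0; simpa using h0

lemma sqle {x : H} (h : ‖x‖ ≤ 1) : 0 ≤ 1 - ‖x‖ ^ 2 := by nlinarith [norm_nonneg x]

lemma bul_schur {f : PS} (hf : Schur f) {w : H} (hw : ‖w‖ < 1) : Schur (bul w f) := by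
  refine schur_of (conv_bul hf hw) (fun q hq => ?_)
  obtain ⟨y, hy, h⟩ := bul_ev hf hw hq
  rw [h]
  have := sq_pos' hw
  have := sqle (hf.2 y (by rwa [hy]))
  positivity

lemma bul_inn {f : PS} (hf : Schur f) (hi : Inn f) {w : H} (hw : ‖w‖ < 1) : Inn (bul w f) := by
  obtain ⟨K, hK0, hK⟩ := hi.nonneg
  refine ⟨K * (1 - ‖w‖ ^ 2) / (1 - ‖w‖) ^ 2, fun q hq => ?_⟩
  obtain ⟨y, hy, h⟩ := bul_ev hf hw hq
  have hy1 : ‖y‖ < 1 := by rwa [hy]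
  have h1 := sq_pos' hw
  have h2 := sq_pos' hq
  have h3 := sq_bd' hw (hf.2 y hy1)
  have h4 : 0 < 1 - ‖w‖ := by linarith
  have h5 := hK y hy1
  rw [hy] at h5
  rw [h, div_mul_eq_mul_div]
  have h6 := sqle (hf.2 y hy1)
  calc _ ≤ K * (1 - ‖q‖ ^ 2) * (1 - ‖w‖ ^ 2) / (1 - ‖w‖) ^ 2 := by
        gcongr; exact h3.2
    _ = _ := by ring

lemma bul_rel {f : PS} (hf : Schur f) {w : H} (hw : ‖w‖ < 1) :
    f * (1 + C (star w) * bul w f) = bul w f + C w := by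
  have h : U1 w f * bul w f = f - C w := by rw [bul, ← mul_assoc, mul_inv' (U1_c hf hw), one_mul]
  rw [U1, sub_mul, one_mul, sub_eq_iff_eq_add] at h
  rw [mul_add, mul_one, ← mul_assoc]
  conv_rhs => rw [h]
  abel

lemma bul_bul {f : PS} (hf : Schur f) {w : H} (hw : ‖w‖ < 1) : bul (-w) (bul w f) = f := by
  have h : bul w f * U2 w f = f - C w := by rw [bul_eq hf hw, mul_assoc, inv_mul' (U2_c hf hw), mul_one]
  have h2 : U1 (-w) (bul w f) * f = bul w f - C (-w) := by
    rw [U2, mul_sub, mul_one, sub_eq_iff_eq_add] at h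
    rw [U1, sub_mul, one_mul, star_neg, map_neg, map_neg, mul_neg, neg_mul, sub_neg_eq_add, sub_neg_eq_add]
    conv_rhs => rw [h]
    rw [mul_assoc]; abel
  rw [bul, ← h2, ← mul_assoc, inv_mul' (U1_c (bul_schur hf hw) (by simpa using hw)), one_mul]

lemma inn_of_bul {f : PS} (hf : Schur f) {w : H} (hw : ‖w‖ < 1) (hi : Inn (bul w f)) : Inn f := by
  rw [← bul_bul hf hw]
  exact bul_inn (bul_schur hf hw) hi (by simpa using hw)

/-! Schwarz -/

lemma exists_x (p q : H) (h : ‖q‖ ≠ ‖p‖) : ∃ x : H, ‖x‖ = ‖q‖ ∧ x - p ≠ 0 ∧ cj (x - p) x = q := by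
  have hc : q - star p ≠ 0 := by
    intro h0; rw [sub_eq_zero] at h0; rw [h0, norm_star] at h; exact h rfl
  set c := q - star p with hcd
  have hx : ‖cj c q‖ = ‖q‖ := norm_cj hc q
  have hxp : cj c q - p ≠ 0 := by
    intro h0; rw [sub_eq_zero] at h0; rw [← hx, h0] at h; exact h rfl
  refine ⟨cj c q, hx, hxp, ?_⟩
  set s := q * c - c * p with hs
  have e1 : c * (cj c q - p) = s := by
    rw [mul_sub, cj, ← mul_assoc, ← mul_assoc, mul_inv_cancel₀ hc, one_mul]
  have e2 : q * s = s * q := by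
    have e3 : s = q * q - q * (star p + p) + star p * p := by
      rw [hs, hcd]; noncomm_ring
    have e4 : star p + p = ((2 * p.re : ℝ) : H) := by
      rw [add_comm, Quaternion.self_add_star, Quaternion.coe_mul]; rfl
    rw [e3, e4, Quaternion.star_mul_self]
    have c1 := Quaternion.coe_commutes (2 * p.re) q
    have c2 := Quaternion.coe_commutes (Quaternion.normSq p) q
    generalize ((2 * p.re : ℝ) : H) = A at *
    generalize ((Quaternion.normSq p : ℝ) : H) = B at *
    rw [mul_add, add_mul, c2, mul_sub, sub_mul, mul_assoc q A q, c1, mul_assoc]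
  have e5 : cj c q - p = c⁻¹ * s := by rw [← e1, ← mul_assoc, inv_mul_cancel₀ hc, one_mul]
  have hs0 : s ≠ 0 := by rw [← e1]; exact mul_ne_zero hc hxp
  rw [e5]
  simp only [cj, mul_inv_rev, inv_inv]
  calc _ = s⁻¹ * (c * c⁻¹) * q * (c * c⁻¹) * s := by simp only [mul_assoc]
    _ = s⁻¹ * (q * s) := by rw [mul_inv_cancel₀ hc]; simp only [mul_one, mul_assoc]
    _ = q := by rw [e2, ← mul_assoc, inv_mul_cancel₀ hs0, one_mul]

lemma schwarz_pt {p : H} (hp : ‖p‖ < 1) {g h : PS} (hg : Conv g) (hh : Conv h) (e : xm p * g = lin p * h)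
    {q : H} (hq : ‖q‖ < 1) (hqp : ‖q‖ ≠ ‖p‖) :
    ∃ x y : H, ‖x‖ = ‖q‖ ∧ ‖y‖ = ‖q‖ ∧ ‖ev g q‖ * ‖x - p‖ = ‖1 - x * star p‖ * ‖ev h y‖ := by
  obtain ⟨x, hx, hxp, hc⟩ := exists_x p q hqp
  have hx1 : ‖x‖ < 1 := by rwa [hx]
  have h1 := ev_mul (conv_xm p) hg hx1
  rw [e, ev_mul (conv_lin p) hh hx1, ev_xm, ev_lin, hc] at h1
  have h2 := (sq_bd hp hx1).1
  refine ⟨x, cj (1 - x * star p) x, hx, ?_, ?_⟩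
  · rw [norm_cj _ x, hx]; simpa using h2
  · rw [← norm_mul (1 - x * star p), h1, norm_mul, mul_comm]

lemma schwarz {p : H} (hp : ‖p‖ < 1) {g h : PS} (hg : Conv g) (hh : Schur h) (e : xm p * g = lin p * h) : Schur g := by
  refine schur_of hg (fun q hq => ?_)
  have hlim : Filter.Tendsto (fun r : ℝ => 1 + (1 - r ^ 2) * (1 - ‖p‖ ^ 2) / (r - ‖p‖) ^ 2) (nhdsWithin 1 (Set.Iio 1))
      (nhds (1 + (1 - 1 ^ 2) * (1 - ‖p‖ ^ 2) / (1 - ‖p‖) ^ 2)) := by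
    apply Filter.Tendsto.mono_left _ nhdsWithin_le_nhds
    apply ContinuousAt.tendsto
    have : (1 - ‖p‖) ^ 2 ≠ 0 := by
      have : 0 < 1 - ‖p‖ := by linarith
      positivity
    fun_prop (disch := assumption)
  have hM : max (max ‖p‖ ‖q‖) (1/2) < 1 := max_lt (max_lt hp hq) (by norm_num)
  have hev : ∀ᶠ r in nhdsWithin (1:ℝ) (Set.Iio 1), ‖ev g q‖ ^ 2 ≤ 1 + (1 - r ^ 2) * (1 - ‖p‖ ^ 2) / (r - ‖p‖) ^ 2 := by
    filter_upwards [Ioo_mem_nhdsLT hM] with r hr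
    have hrp : ‖p‖ < r := ((le_max_left _ _).trans (le_max_left _ _)).trans_lt hr.1
    have hrq : ‖q‖ < r := ((le_max_right _ _).trans (le_max_left _ _)).trans_lt hr.1
    have hr0 : 0 < r := (norm_nonneg _).trans_lt hrp
    set M := 1 + (1 - r ^ 2) * (1 - ‖p‖ ^ 2) / (r - ‖p‖) ^ 2
    have hpp := sq_pos' hp
    have hrr : 0 < 1 - r ^ 2 := by nlinarith [hr.2]
    have hM0 : 0 ≤ M := by positivity
    have := ev_max hg hr0 hr.2 (M := Real.sqrt M) ?_ hrq.le
    · calc _ ≤ (Real.sqrt M) ^ 2 := by gcongr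
        _ = M := Real.sq_sqrt hM0
    · intro z hz
      obtain ⟨x, y, hx, hy, hxy⟩ := schwarz_pt hp hg hh.1 e (q := z) (by rw [hz]; exact hr.2) (by rw [hz]; exact hrp.ne')
      have hh1 := hh.2 y (by rw [hy, hz]; exact hr.2)
      apply Real.le_sqrt_of_sq_le
      have hd : r - ‖p‖ ≤ ‖x - p‖ := by
        have := norm_sub_norm_le x p; rwa [hx, hz] at this
      have hd0 : 0 < r - ‖p‖ := by linarith
      have hd1 : 0 < ‖x - p‖ := by linarith
      have hn := nid x p
      rw [hx, hz] at hn
      have k1 : ‖ev g z‖ ^ 2 * ‖x - p‖ ^ 2 ≤ ‖x - p‖ ^ 2 + (1 - r ^ 2) * (1 - ‖p‖ ^ 2) := by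
        rw [← mul_pow, hxy, mul_pow, ← hn]
        have : ‖1 - x * star p‖ ^ 2 * ‖ev h y‖ ^ 2 ≤ ‖1 - x * star p‖ ^ 2 * 1 := by
          gcongr; nlinarith [norm_nonneg (ev h y)]
        linarith
      have k2 : ‖ev g z‖ ^ 2 ≤ 1 + (1 - r ^ 2) * (1 - ‖p‖ ^ 2) / ‖x - p‖ ^ 2 := by
        rw [← le_div_iff₀ (by positivity)] at k1
        refine k1.trans (le_of_eq ?_)
        field_simp
      refine k2.trans ?_
      simp only [M]
      gcongr
  have := ge_of_tendsto hlim hev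
  norm_num at this
  have h0 := norm_nonneg (ev g q)
  nlinarith

lemma schwarz_inn {p : H} (hp : ‖p‖ < 1) {g h : PS} (hg : Conv g) (hh : Conv h) (hi : Inn h) (e : xm p * g = lin p * h) : Inn g := by
  obtain ⟨K, hK0, hK⟩ := hi.nonneg
  have hpp := sq_pos' hp
  refine ⟨K + (1 - ‖p‖ ^ 2)⁻¹, fun q hq => ?_⟩
  have hqq := sq_pos' hq
  by_cases hqp : ‖q‖ = ‖p‖
  · rw [hqp, add_mul, inv_mul_cancel₀ hpp.ne']
    have := mul_nonneg hK0 hpp.le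
    nlinarith [sq_nonneg ‖ev g q‖]
  · obtain ⟨x, y, hx, hy, hxy⟩ := schwarz_pt hp hg hh e hq hqp
    have h1 := hK y (by rwa [hy])
    rw [hy] at h1
    have hn := nid x p
    rw [hx] at hn
    have hxp : 0 < ‖x - p‖ := by
      rw [norm_pos_iff, sub_ne_zero]; rintro rfl; exact hqp hx.symm
    have h3 : ‖ev h y‖ ≤ ‖ev g q‖ := by
      have : ‖x - p‖ ≤ ‖1 - x * star p‖ := by
        apply le_of_sq_le_sq _ (norm_nonneg _)
        nlinarith [mul_nonneg hqq.le hpp.le]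
      have : ‖ev h y‖ * ‖x - p‖ ≤ ‖ev g q‖ * ‖x - p‖ := by
        rw [hxy]; nlinarith [norm_nonneg (ev h y)]
      exact le_of_mul_le_mul_right this hxp
    have h4 : ‖ev h y‖ ^ 2 ≤ ‖ev g q‖ ^ 2 := by gcongr
    have : 0 ≤ (1 - ‖p‖ ^ 2)⁻¹ * (1 - ‖q‖ ^ 2) := by positivity
    rw [add_mul]; linarith

/-! the hyperbolic difference quotient -/
noncomputable def hd (f : PS) (p : H) : PS := lin p * dq f p * inv (U2 (ev f p) f)

lemma hd_conv {f : PS} (hf : Schur f) {p : H} (hp : ‖p‖ < 1) (hw : ‖ev f p‖ < 1) : Conv (hd f p) :=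
  ((conv_lin p).mul (conv_dq hf.1 hp)).mul (conv_inv_U2 hf hw)

lemma hd_rel {f : PS} (hf : Schur f) {p : H} (hp : ‖p‖ < 1) (hw : ‖ev f p‖ < 1) :
    xm p * hd f p = lin p * bul (ev f p) f := by
  rw [bul_eq hf hw, hd]
  have h : f - C (ev f p) = xm p * dq f p := by rw [sub_eq_iff_eq_add']; exact dq_eq hf.1 hp
  rw [h]
  calc _ = xm p * lin p * dq f p * inv (U2 (ev f p) f) := by simp only [mul_assoc]
    _ = _ := by rw [xm_lin]; simp only [mul_assoc]

lemma hd_schur {f : PS} (hf : Schur f) {p : H} (hp : ‖p‖ < 1) (hw : ‖ev f p‖ < 1) : Schur (hd f p) :=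
  schwarz hp (hd_conv hf hp hw) (bul_schur hf hw) (hd_rel hf hp hw)

lemma Mb_hd {f : PS} (hf : Schur f) {p : H} (hp : ‖p‖ < 1) (hw : ‖ev f p‖ < 1) :
    bul (ev f p) f = Mb p * hd f p := by
  apply mul_left_cancel₀ (lin_ne p)
  rw [← mul_assoc, lin_Mb, hd_rel hf hp hw]

def Bl : ℕ → PS → Prop
  | 0, f => ∃ u : H, ‖u‖ = 1 ∧ f = C u
  | k + 1, f => ∃ (t : H) (g : PS), ‖t‖ < 1 ∧ Bl k g ∧ f = Mb t * g

lemma Bl.props {k : ℕ} : ∀ {f : PS}, Bl k f → Schur f ∧ Inn f := by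
  induction k with
  | zero =>
    rintro f ⟨u, hu, rfl⟩
    exact ⟨⟨conv_C u, fun q _ => by rw [ev_C, hu]⟩, ⟨0, fun q _ => by rw [ev_C, hu]; simp⟩⟩
  | succ k ih =>
    rintro f ⟨t, g, ht, hg, rfl⟩
    exact ⟨(Mb_schur ht).mul (ih hg).1, Inn.mul (Mb_schur ht) (ih hg).1 (Mb_inn ht) (ih hg).2⟩

lemma exists_E (t r : H) : ∃ E : PS, IsPoly 1 E ∧ E ≠ 0 ∧ C r * E = lin t * C r := by
  by_cases hr : r = 0
  · exact ⟨1, isPoly_one.mono (by omega), one_ne_zero, by simp [hr]⟩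
  · refine ⟨1 - X * C (r⁻¹ * star t * r), (isPoly_one.mono (by omega)).sub (isPoly_X.mul (isPoly_C _)), ?_, ?_⟩
    · intro h; have := congrArg (coeff 0) h; simp at this
    · rw [lin, mul_sub, sub_mul, mul_one, one_mul, ← mul_assoc, ← X_mul, mul_assoc, mul_assoc, ← map_mul,
        ← mul_assoc r, mul_inv_cancel₀ hr, one_mul, map_mul, mul_assoc]

lemma divide {k : ℕ} {N : PS} (hN : IsPoly k N) (t : H) : ∃ (N' : PS) (r : H), (∀ m, k ≤ m → coeff m N' = 0) ∧
    N = lin t * N' + X ^ k * C r := by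
  set V := inv (lin t) * N with hV
  have hVN : lin t * V = N := by rw [hV, ← mul_assoc, mul_inv' (by simp [coeff_lin]), one_mul]
  set N' : PS := PowerSeries.mk (fun m => if m < k then coeff m V else 0) with hN'
  have hz : ∀ m, k ≤ m → coeff m N' = 0 := fun m hm => by rw [hN', coeff_mk, if_neg (by omega)]
  refine ⟨N', coeff k (N - lin t * N'), hz, ?_⟩
  rw [← sub_eq_iff_eq_add']
  ext1 m
  rw [coeff_mul_C, coeff_X_pow]
  by_cases hmk : m = k
  · simp [hmk]
  rw [if_neg hmk, zero_mul]
  rcases lt_or_gt_of_ne hmk with h | h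
  · rw [← hVN, ← mul_sub, coeff_mul]
    apply Finset.sum_eq_zero
    intro x hx
    rw [Finset.HasAntidiagonal.mem_antidiagonal] at hx
    have : coeff x.2 (V - N') = 0 := by
      rw [map_sub, hN', coeff_mk, if_pos (by omega), sub_self]
    rw [this, mul_zero]
  · rw [map_sub, hN m h, lin, sub_mul, map_sub, one_mul, hz m h.le, mul_assoc]
    obtain ⟨j, rfl⟩ : ∃ j, m = j + 1 := ⟨m - 1, by omega⟩
    rw [coeff_succ_X_mul, coeff_C_mul, hz j (by omega)]; simp

lemma Bl.frac {k : ℕ} : ∀ {f : PS}, Bl k f → ∃ D N : PS, D ≠ 0 ∧ IsPoly k D ∧ IsPoly k N ∧ f * D = N := by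
  induction k with
  | zero =>
    rintro f ⟨u, hu, rfl⟩
    exact ⟨1, C u, one_ne_zero, isPoly_one, isPoly_C u, mul_one _⟩
  | succ k ih =>
    rintro f ⟨t, g, ht, hg, rfl⟩
    obtain ⟨D, N, hD, hDp, hNp, h⟩ := ih hg
    obtain ⟨N', r, hN', hN⟩ := divide hNp t
    obtain ⟨E, hE, hE0, hEr⟩ := exists_E t r
    refine ⟨D * E, xm t * (N' * E + X ^ k * C r), mul_ne_zero hD hE0, hDp.mul hE, ?_, ?_⟩
    · rw [add_comm k 1]
      refine (xm_poly t).mul (IsPoly.add ?_ ?_)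
      · cases k with
        | zero =>
          have : N' = 0 := by ext1 m; simpa using hN' m (by omega)
          rw [this, zero_mul]; intro m _; simp
        | succ k => exact IsPoly.mul (fun m hm => hN' m (by omega)) hE
      · intro m hm
        rw [coeff_mul_C, coeff_X_pow, if_neg (by omega), zero_mul]
    · have e1 : N * E = lin t * (N' * E + X ^ k * C r) := by
        rw [hN, add_mul, mul_assoc, mul_assoc, hEr, ← mul_assoc (X ^ k), X_pow_mul, mul_add]
        simp only [mul_assoc]
      rw [← mul_assoc, mul_assoc (Mb t), h, mul_assoc, e1, ← mul_assoc, Mb_lin]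

lemma peel (k : ℕ) : ∀ f D U U' N : PS, Schur f → Inn f → Conv D → Conv U → Conv U' → U * U' = 1 → N ≠ 0 →
    IsPoly k N → f * D = U * N → ∃ κ ≤ k, Bl κ f := by
  induction k with
  | zero =>
    intro f D U U' N hf hi hD hU hU' hUU hN0 hN e
    by_cases hex : ∃ q : H, ‖q‖ < 1 ∧ ‖ev f q‖ = 1
    · obtain ⟨q, hq, h1⟩ := hex
      obtain ⟨u, hu, rfl⟩ := schur_const hf hq h1
      exact ⟨0, le_rfl, u, hu, rfl⟩
    · push Not at hex
      obtain ⟨t, ht, htz⟩ := exists_zero hf.1 (fun q hq => lt_of_le_of_ne (hf.2 q hq) (hex q hq)) hi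
      exfalso
      have h1 := ev_mul hf.1 hD ht
      have h2 := ev_mul hU hU' ht
      rw [e, htz, zero_mul, ev_mul hU hN.conv ht, hN.ev] at h1
      rw [hUU, ev_one] at h2
      have h3 : ev U t ≠ 0 := by intro h0; rw [h0] at h2; simp at h2
      apply hN0
      ext1 m
      cases m with
      | zero => simpa [h3] using h1
      | succ m => rw [hN _ (by omega)]; simp
  | succ k ih =>
    intro f D U U' N hf hi hD hU hU' hUU hN0 hN e
    by_cases hex : ∃ q : H, ‖q‖ < 1 ∧ ‖ev f q‖ = 1
    · obtain ⟨q, hq, h1⟩ := hex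
      obtain ⟨u, hu, rfl⟩ := schur_const hf hq h1
      exact ⟨0, by omega, u, hu, rfl⟩
    · push Not at hex
      obtain ⟨t, ht, htz⟩ := exists_zero hf.1 (fun q hq => lt_of_le_of_ne (hf.2 q hq) (hex q hq)) hi
      set R := dq f t with hR
      have hfR : f = xm t * R := factor_zero hf.1 ht htz
      have hRc : Conv R := conv_dq hf.1 ht
      set g := lin t * R with hg
      have hgc : Conv g := (conv_lin t).mul hRc
      have hxg : xm t * g = lin t * f := by
        rw [hg, ← mul_assoc, xm_lin, mul_assoc, ← hfR]
      have hgs := schwarz ht hgc hf hxg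
      have hgi := schwarz_inn ht hgc hf.1 hi hxg
      have hfg : f = Mb t * g := by
        apply mul_left_cancel₀ (lin_ne t)
        rw [← mul_assoc, lin_Mb, hxg]
      have hl := mul_inv' (f := lin t) (by simp [coeff_lin])
      set W := lin t * U with hW
      set W' := U' * inv (lin t) with hW'
      have hWc : Conv W := (conv_lin t).mul hU
      have hWc' : Conv W' := hU'.mul (conv_inv_lin ht)
      have hWW : W * W' = 1 := by
        rw [hW, hW']
        calc _ = lin t * (U * U') * inv (lin t) := by simp only [mul_assoc]
          _ = 1 := by rw [hUU, mul_one, hl]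
      have e2 : xm t * (g * D) = W * N := by
        rw [← mul_assoc, hxg, mul_assoc, e, ← mul_assoc]
      have h1 := ev_mul (conv_xm t) (hgc.mul hD) ht
      rw [e2, ev_xm, sub_self, zero_mul, ev_mul hWc hN.conv ht] at h1
      have h2 := ev_mul hWc hWc' ht
      rw [hWW, ev_one] at h2
      set c := ev W t with hc
      have hc0 : c ≠ 0 := by intro h0; rw [h0] at h2; simp at h2
      set t' := cj c t with ht'
      have ht'1 : ‖t'‖ < 1 := norm_cj_lt c ht
      have hNt : ev N t' = 0 := by simpa [hc0] using h1
      have hNf := factor_zero hN.conv ht'1 hNt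
      set N' := dq N t' with hN'
      have hN'p : IsPoly k N' := factor_poly hN
      have hN'0 : N' ≠ 0 := by intro h0; rw [h0, mul_zero] at hNf; exact hN0 hNf
      have hV := factor_zero (hWc.mul (conv_xm t')) ht (by
        rw [ev_mul hWc (conv_xm t') ht, ev_xm, ← hc, ← ht', sub_self, mul_zero])
      have hVc := conv_dq (hWc.mul (conv_xm t')) ht
      set V := dq (W * xm t') t
      have hV' := factor_zero (hWc'.mul (conv_xm t)) ht'1 (by
        rw [ev_mul hWc' (conv_xm t) ht'1, ev_xm]
        have h3 : ev W' t' = c⁻¹ := (inv_eq_of_mul_eq_one_right h2.symm).symm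
        have h4 : cj (ev W' t') t' = t := by
          rw [h3, ht', cj, cj, inv_inv]
          calc _ = (c * c⁻¹) * t * (c * c⁻¹) := by simp only [mul_assoc]
            _ = t := by rw [mul_inv_cancel₀ hc0, one_mul, mul_one]
        rw [h4, sub_self, mul_zero])
      have hVc' := conv_dq (hWc'.mul (conv_xm t)) ht'1
      set V' := dq (W' * xm t) t'
      have hVV : V * V' = 1 := by
        apply mul_left_cancel₀ (xm_ne t)
        rw [← mul_assoc, ← hV, mul_assoc, ← hV', ← mul_assoc, hWW, one_mul, mul_one]
      have e3 : g * D = V * N' := by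
        apply mul_left_cancel₀ (xm_ne t)
        rw [e2, hNf, ← mul_assoc, hV, mul_assoc]
      obtain ⟨κ, hκ, hb⟩ := ih g D V V' N' hgs hgi hD hVc hVc' hVV hN'0 hN'p e3
      exact ⟨κ + 1, by omega, t, g, ht, hb, hfg⟩

lemma inn_C {c : H} (h : Inn (C c)) : 1 ≤ ‖c‖ := by
  obtain ⟨K, hK0, hK⟩ := h.nonneg
  by_contra hc
  push Not at hc
  have hcc := sq_pos' hc
  set δ := 1 - ‖c‖ ^ 2
  set ε := min (1/2) (δ / (2 * (K + 1))) with hε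
  have h0 : 0 < ε := by positivity
  have h1 : ε ≤ 1/2 := min_le_left _ _
  have h2 : ε * (2 * (K + 1)) ≤ δ := by
    rw [← le_div_iff₀ (by positivity)]; exact min_le_right _ _
  have hn : ‖((1 - ε : ℝ) : H)‖ = 1 - ε := by
    rw [Quaternion.norm_coe, Real.norm_of_nonneg (by linarith)]
  have := hK ((1 - ε : ℝ) : H) (by rw [hn]; linarith)
  rw [hn, ev_C] at this
  change δ ≤ _ at this
  nlinarith [mul_nonneg hK0 (sq_nonneg ε)]

lemma hd_Bl {f : PS} (hf : Schur f) {p : H} (hp : ‖p‖ < 1) (hw : ‖ev f p‖ < 1) {κ : ℕ} (h : Bl κ (hd f p)) :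
    ∃ κ' ≤ κ + 1, Bl κ' f := by
  set w := ev f p with hwd
  have hb : Bl (κ + 1) (bul w f) := ⟨p, hd f p, hp, h, Mb_hd hf hp hw⟩
  have hi : Inn f := inn_of_bul hf hw hb.props.2
  obtain ⟨D, N, hD, hDp, hNp, e⟩ := hb.frac
  have hne : bul w f + C w ≠ 0 := by
    intro h0
    have h1 : bul w f = C (-w) := by rw [map_neg]; exact eq_neg_of_add_eq_zero_left h0
    have := hb.props.2
    rw [h1] at this
    have := inn_C this
    rw [norm_neg] at this; linarith
  have e2 : f * (D + C (star w) * N) = (1 : PS) * (N + C w * D) := by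
    have := congrArg (· * D) (bul_rel hf hw)
    simp only [mul_assoc, add_mul, one_mul, e] at this
    rw [this, one_mul]
  refine peel (κ + 1) f (D + C (star w) * N) 1 1 (N + C w * D) hf hi ?_ conv_one conv_one (mul_one 1) ?_ ?_ e2
  · exact hDp.conv.add ((conv_C _).mul hNp.conv)
  · rw [← e, ← add_mul]; exact mul_ne_zero hne hD
  · refine hNp.add ?_
    have := (isPoly_C w).mul hDp
    rwa [zero_add] at this

/-! translation -/
lemma mk_oneMinus (p : H) : PowerSeries.mk (oneMinusQPbarC p) = lin p := by
  ext1 m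
  rw [lin, map_sub, coeff_XC, coeff_one, coeff_mk, oneMinusQPbarC]
  rcases m with _ | _ | m <;> simp
lemma mk_qMinus (p : H) : PowerSeries.mk (qMinusPC p) = xm p := by
  ext1 m
  rw [xm, map_sub, coeff_X, coeff_C, coeff_mk, qMinusPC]
  rcases m with _ | _ | m <;> simp
lemma mk_starInv (a : ℕ → H) : PowerSeries.mk (starInvC a) = inv (PowerSeries.mk a) := by
  simp [inv]
lemma mk_mobius (p : H) : PowerSeries.mk (mobiusC p) = Mb p := by
  rw [mobiusC, mk_starMul, mk_starInv, mk_oneMinus, mk_qMinus, Mb]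

lemma Bl_isBl {κ : ℕ} : ∀ {a : ℕ → H}, Bl κ (PowerSeries.mk a) → IsBlaschke a κ := by
  induction κ with
  | zero =>
    rintro a ⟨u, hu, h⟩
    refine ⟨[], u, rfl, by simp, hu, ?_⟩
    ext1 m
    have := congrArg (coeff m) h
    rw [coeff_mk, coeff_C] at this
    rw [this, blaschkeListC]; by_cases hm : m = 0 <;> simp [hm]
  | succ κ ih =>
    rintro a ⟨t, g, ht, hg, h⟩
    have eg : g = PowerSeries.mk (fun m => coeff m g) := by ext1 m; simp
    rw [eg] at hg
    obtain ⟨ts, u, hl, hts, hu, e⟩ := ih hg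
    refine ⟨t :: ts, u, by simp [hl], ?_, hu, ?_⟩
    · intro s hs
      rcases List.mem_cons.1 hs with rfl | hs
      · exact ht
      · exact hts s hs
    · have e1 : g = PowerSeries.mk (blaschkeListC ts) * C u := by
        ext1 m; rw [coeff_mul_C, coeff_mk]; exact congrFun e m
      ext1 m
      have := congrArg (coeff m) h
      rw [coeff_mk, e1, ← mul_assoc, ← mk_mobius, ← mk_starMul, coeff_mul_C, coeff_mk] at this
      exact this

lemma self_iff (a : ℕ → H) : SelfMap a ↔ Conv (PowerSeries.mk a) ∧ ∀ q : H, ‖q‖ < 1 → ‖ev (PowerSeries.mk a) q‖ < 1 := by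
  simp [SelfMap, Conv, ev]

lemma mk_hdq (a : ℕ → H) (p : H) : PowerSeries.mk (hdqC a p) = hd (PowerSeries.mk a) p := by
  rw [hdqC, mk_starMul, mk_starMul, mk_starInv, mk_oneMinus, hd, dq]
  simp only [coeff_mk]
  congr 2
  ext1 m
  rw [coeff_mk, U2, map_sub, coeff_C_mul, coeff_one, coeff_mk]
  simp [ev]

lemma isBl_Bl (ts : List H) (u : H) (hu : ‖u‖ = 1) (hts : ∀ t ∈ ts, ‖t‖ < 1) :
    Bl ts.length (PowerSeries.mk (blaschkeListC ts) * C u) := by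
  induction ts with
  | nil =>
    refine ⟨u, hu, ?_⟩
    ext1 m
    rw [coeff_mul_C, coeff_mk, coeff_C, blaschkeListC]; by_cases hm : m = 0 <;> simp [hm]
  | cons t ts ih =>
    refine ⟨t, _, hts t (by simp), ih (fun s hs => hts s (by simp [hs])), ?_⟩
    rw [blaschkeListC, mk_starMul, mk_mobius, mul_assoc]

lemma step {n : ℕ} {a : ℕ → H} (ha : SelfMap a) (hnot : ∀ κ, κ ≤ n + 1 → ¬ IsBlaschke a κ) {p : H} (hp : ‖p‖ < 1) :
    SelfMap (hdqC a p) ∧ ∀ κ, κ ≤ n → ¬ IsBlaschke (hdqC a p) κ := by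
  rw [self_iff] at ha
  set f := PowerSeries.mk a with hf
  have hs : Schur f := ⟨ha.1, fun q hq => (ha.2 q hq).le⟩
  have hw := ha.2 p hp
  have key : ∀ κ, κ ≤ n → ¬ Bl κ (hd f p) := by
    intro κ hκ hb
    obtain ⟨κ', hκ', hb'⟩ := hd_Bl hs hp hw hb
    exact hnot κ' (by omega) (Bl_isBl hb')
  have hg := hd_schur hs hp hw
  refine ⟨?_, ?_⟩
  · rw [self_iff, mk_hdq]
    refine ⟨hg.1, fun q hq => lt_of_le_of_ne (hg.2 q hq) (fun h => ?_)⟩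
    obtain ⟨u, hu, e⟩ := schur_const hg hq h
    exact key 0 (by omega) ⟨u, hu, e⟩
  · rintro κ hκ ⟨ts, u, hl, hts, hu, e⟩
    apply key κ hκ
    have := isBl_Bl ts u hu hts
    rw [hl] at this
    convert this
    rw [hf, ← mk_hdq, e]
    ext1 m
    rw [coeff_mul_C, coeff_mk, coeff_mk]

lemma iter (ps : List H) : ∀ (a : ℕ → H), SelfMap a → (∀ κ, κ ≤ ps.length → ¬ IsBlaschke a κ) →
    (∀ p ∈ ps, ‖p‖ < 1) → ∀ κ, SelfMap (ihdqC a (ps.take κ)) := by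
  induction ps with
  | nil => intro a ha _ _ κ; simpa [ihdqC] using ha
  | cons p ps ih =>
    intro a ha hnot hp κ
    cases κ with
    | zero => simpa [ihdqC] using ha
    | succ κ =>
      have := step (n := ps.length) ha (by simpa using hnot) (hp p (by simp))
      rw [List.take_succ_cons, ihdqC]
      exact ih _ this.1 this.2 (fun q hq => hp q (by simp [hq])) κ

theorem main' (n : ℕ) (hn : 1 ≤ n) (a : ℕ → H) (ha : SelfMap a)
    (hnot : ∀ κ, κ ≤ n → ¬ IsBlaschke a κ)
    (p : Fin n → H) (hp : ∀ i, ‖p i‖ < 1) :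
    (∀ κ, 1 ≤ κ → κ ≤ n → SelfMap (ihdqC a ((List.ofFn p).take κ))) ∧
    (∀ q : H, ‖q‖ < 1 → ‖evalC (ihdqC a (List.ofFn p)) q‖ < 1) := by
  have h := iter (List.ofFn p) a ha (by simpa using hnot) (by
    intro q hq
    obtain ⟨i, rfl⟩ := List.mem_ofFn.1 hq
    exact hp i)
  refine ⟨fun κ _ _ => h κ, fun q hq => ?_⟩
  have h2 := (h n).2 q hq
  rwa [List.take_of_length_le (by simp)] at h2



end Helpers

/-- If `f` is a slice regular self-map of `𝔹` which is not a regular Blaschke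
product of degree `≤ n`, then all iterated hyperbolic difference quotients up
to step `n` are slice regular self-maps of `𝔹`, and the `n`-th one satisfies
`|f^{⟨n⟩}(q)| < 1` on `𝔹`. -/
theorem iterated_hdq_selfMap (n : ℕ) (hn : 1 ≤ n) (a : ℕ → H) (ha : SelfMap a)
    (hnot : ∀ κ, κ ≤ n → ¬ IsBlaschke a κ)
    (p : Fin n → H) (hp : ∀ i, ‖p i‖ < 1) :
    (∀ κ, 1 ≤ κ → κ ≤ n → SelfMap (ihdqC a ((List.ofFn p).take κ))) ∧
    (∀ q : H, ‖q‖ < 1 → ‖evalC (ihdqC a (List.ofFn p)) q‖ < 1) := by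
  exact main' n hn a ha hnot p hp

end QPaper
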